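/- arXiv:math/0607331 — 3 statements merged into one kernel-verified Lean document; each statement's English description precedes it below -/
import Mathlib

section
/- Let B < ∞ and let (f_n) be a sequence of functions f_n : [0,∞) → ℝ with f_n(0) = 0, each differentiable with derivative f_n′, and satisfying ∫₀^∞ [f_n′(x)² + (1+x) f_n(x)²] dx ≤ B for all n. Then there exist a strictly increasing sequence of indices (n_j) and a continuous function f : [0,∞) → ℝ with f(0) = 0 and ∫₀^∞ (1+x) f(x)² dx ≤ B such that f_{n_j} → f in L²([0,∞)) and f_{n_j} → f uniformly on every compact subset of [0,∞). -/
open MeasureTheory Set Filter Topology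

noncomputable section

/-- A function on `[0, ∞)` whose derivative has bounded `L²` norm is Hölder of order `1/2`. -/
theorem dist_le_mul_sqrt_of_lintegral_deriv_sq_le {u : ℝ → ℝ} {B : ℝ} (hB : 0 ≤ B)
    (hu : ∀ x ∈ Ici (0:ℝ), DifferentiableAt ℝ u x)
    (hbound : ∫⁻ x in Ioi (0:ℝ), ENNReal.ofReal (deriv u x ^ 2) ≤ ENNReal.ofReal B)
    {x y : ℝ} (hx : 0 ≤ x) (hy : 0 ≤ y) :
    dist (u x) (u y) ≤ (B + 1) * √(dist x y) := by
  wlog hxy : x ≤ y generalizing x y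
  · rw [dist_comm, dist_comm x]
    exact this hy hx (le_of_not_ge hxy)
  rcases hxy.eq_or_lt with rfl | hlt
  · simp
  have hsub : Ioc x y ⊆ Ioi 0 := fun t ht => hx.trans_lt ht.1
  have hmeas : Measurable fun t => deriv u t ^ 2 := (measurable_deriv u).pow_const 2
  have hle : ∫⁻ t in Ioc x y, ENNReal.ofReal (deriv u t ^ 2) ≤ ENNReal.ofReal B :=
    (lintegral_mono_set hsub).trans hbound
  have hsq : IntegrableOn (fun t => deriv u t ^ 2) (Ioc x y) := by
    refine ⟨hmeas.aestronglyMeasurable, ?_⟩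
    rw [hasFiniteIntegral_iff_ofReal (ae_of_all _ fun t => sq_nonneg _)]
    exact hle.trans_lt ENNReal.ofReal_lt_top
  have hsqB : ∫ t in Ioc x y, deriv u t ^ 2 ≤ B := by
    rw [integral_eq_lintegral_of_nonneg_ae (ae_of_all _ fun t => sq_nonneg _)
      hmeas.aestronglyMeasurable]
    exact ENNReal.toReal_le_of_le_ofReal hB hle
  set d := √(y - x) with hd
  have hd0 : 0 < d := Real.sqrt_pos.2 (sub_pos.2 hlt)
  have hdd : d * d = y - x := Real.mul_self_sqrt (sub_nonneg.2 hxy)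
  have hmajor : IntegrableOn (fun t => d * deriv u t ^ 2 + d⁻¹) (Ioc x y) :=
    (hsq.const_mul d).add (by simp)
  have hpt : ∀ t, ‖deriv u t‖ ≤ d * deriv u t ^ 2 + d⁻¹ := fun t => by
    have h1 : d * d⁻¹ = 1 := mul_inv_cancel₀ hd0.ne'
    have h2 := mul_nonneg (inv_nonneg.2 hd0.le) (sq_nonneg (d * |deriv u t| - 1))
    have h3 : d⁻¹ * (d * |deriv u t| - 1) ^ 2
        = d * deriv u t ^ 2 - 2 * |deriv u t| + d⁻¹ := by
      rw [← sq_abs (deriv u t)]; field_simp; ring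
    rw [Real.norm_eq_abs]
    linarith [abs_nonneg (deriv u t)]
  have hint : IntegrableOn (deriv u) (Ioc x y) :=
    hmajor.mono' (measurable_deriv u).aestronglyMeasurable (ae_of_all _ hpt)
  have hftc : ∫ t in x..y, deriv u t = u y - u x := by
    refine intervalIntegral.integral_eq_sub_of_hasDerivAt (fun t ht => ?_)
      ((intervalIntegrable_iff_integrableOn_Ioc_of_le hxy).2 hint)
    rw [uIcc_of_le hxy] at ht
    exact (hu t (hx.trans ht.1)).hasDerivAt
  rw [dist_comm, dist_comm x, Real.dist_eq, Real.dist_eq, abs_of_pos (sub_pos.2 hlt), ← hftc,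
    intervalIntegral.integral_of_le hxy, ← hd]
  calc |∫ t in Ioc x y, deriv u t| ≤ ∫ t in Ioc x y, (d * deriv u t ^ 2 + d⁻¹) :=
        norm_integral_le_of_norm_le hmajor (ae_of_all _ hpt)
    _ = d * (∫ t in Ioc x y, deriv u t ^ 2) + d := by
        rw [integral_add (hsq.const_mul d) (by simp), integral_const_mul]
        simp [← hdd, mul_self_nonneg, hd0.ne']
    _ ≤ (B + 1) * d := by nlinarith

/-- The continuous functions vanishing at a given point and sharing a modulus of continuity
form a compact set for uniform convergence on compact sets. -/
theorem isCompact_setOf_dist_le_modulus {X : Type*} [PseudoMetricSpace X] (x₀ : X) {b : ℝ → ℝ}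
    (hb : Tendsto b (𝓝 0) (𝓝 0)) :
    IsCompact {F : C(X, ℝ) | F x₀ = 0 ∧ ∀ x y, dist (F x) (F y) ≤ b (dist x y)} := by
  refine ArzelaAscoli.isCompact_of_equicontinuous _ ?_
    (Metric.equicontinuous_of_continuity_modulus b hb _ fun x y F => F.2.2 x y)
  have himage : ContinuousMap.toFun ''
      {F : C(X, ℝ) | F x₀ = 0 ∧ ∀ x y, dist (F x) (F y) ≤ b (dist x y)}
      = {h : X → ℝ | h x₀ = 0 ∧ ∀ x y, dist (h x) (h y) ≤ b (dist x y)} := by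
    ext h
    refine ⟨?_, fun hh => ?_⟩
    · rintro ⟨F, hF, rfl⟩
      exact hF
    · have hc : Continuous h := (Metric.equicontinuous_of_continuity_modulus b hb
        (fun _ : Unit => h) fun x y _ => hh.2 x y).continuous ()
      exact ⟨⟨h, hc⟩, hh, rfl⟩
  rw [himage]
  refine IsCompact.of_isClosed_subset
    (isCompact_univ_pi fun x => isCompact_closedBall (0:ℝ) (b (dist x x₀))) ?_ ?_
  · simp only [ofPred_and, ofPred_forall]
    exact (isClosed_eq (continuous_apply x₀) continuous_const).inter
      (isClosed_iInter fun x => isClosed_iInter fun y =>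
        isClosed_le ((continuous_apply x).dist (continuous_apply y)) continuous_const)
  · intro h hh x _
    rw [Metric.mem_closedBall, ← hh.1]
    exact hh.2 x x₀

/-- Local uniform convergence together with a uniform bound on the `L²` norms with weight `1 + x`
gives `L²` convergence. -/
theorem tendsto_integral_sub_sq_of_weighted_bound {F : ℕ → ℝ → ℝ} {g : ℝ → ℝ} {B : ℝ}
    (hF : ∀ n, Continuous (F n)) (hg : Continuous g)
    (hFB : ∀ n, ∫⁻ x in Ioi (0:ℝ), ENNReal.ofReal ((1 + x) * F n x ^ 2) ≤ ENNReal.ofReal B)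
    (hgB : ∫⁻ x in Ioi (0:ℝ), ENNReal.ofReal ((1 + x) * g x ^ 2) ≤ ENNReal.ofReal B)
    (hlim : ∀ K : Set ℝ, IsCompact K → TendstoUniformlyOn F g atTop K) :
    Tendsto (fun n => ∫ x in Ioi (0:ℝ), (F n x - g x) ^ 2) atTop (𝓝 0) := by
  wlog hB : 0 ≤ B generalizing B
  · rw [ENNReal.ofReal_of_nonpos (le_of_not_ge hB), ← ENNReal.ofReal_zero] at hFB hgB
    exact this hFB hgB le_rfl
  rw [Metric.tendsto_atTop]
  intro ε hε
  obtain ⟨R, hR0, hR⟩ : ∃ R : ℝ, 0 < R ∧ 4 * B / (1 + R) < ε / 2 := by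
    refine ⟨8 * B / ε + 1, by positivity, ?_⟩
    rw [div_lt_iff₀ (by positivity)]
    have : 8 * B / ε * ε = 8 * B := div_mul_cancel₀ _ hε.ne'
    nlinarith
  set δ := √(ε / (4 * R)) with hδ
  have hδ0 : 0 < δ := Real.sqrt_pos.2 (by positivity)
  have hδR : δ ^ 2 * R = ε / 4 := by
    rw [hδ, Real.sq_sqrt (by positivity)]; field_simp
  obtain ⟨N, hN⟩ := eventually_atTop.1
    (Metric.tendstoUniformlyOn_iff.1 (hlim (Icc 0 R) isCompact_Icc) δ hδ0)
  refine ⟨N, fun n hn => ?_⟩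
  have hpt : ∀ x ∈ Ioi (0:ℝ), ENNReal.ofReal ((F n x - g x) ^ 2) ≤
      (Ioc 0 R).indicator (fun _ => ENNReal.ofReal (δ ^ 2)) x +
        ENNReal.ofReal (2 / (1 + R)) * (ENNReal.ofReal ((1 + x) * F n x ^ 2) +
          ENNReal.ofReal ((1 + x) * g x ^ 2)) := by
    intro x hx
    have hx0 : 0 < x := hx
    by_cases hxR : x ≤ R
    · rw [indicator_of_mem (show x ∈ Ioc 0 R from ⟨hx, hxR⟩)]
      refine le_add_right (ENNReal.ofReal_le_ofReal ?_)
      have h := hN n hn x ⟨hx0.le, hxR⟩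
      rw [dist_comm, Real.dist_eq] at h
      exact sq_le_sq.2 (h.le.trans (le_abs_self δ))
    · refine le_add_left ?_
      rw [← ENNReal.ofReal_add (by positivity) (by positivity),
        ← ENNReal.ofReal_mul (by positivity)]
      refine ENNReal.ofReal_le_ofReal ?_
      rw [div_mul_eq_mul_div, le_div_iff₀ (by positivity)]
      have hsum : 0 ≤ (x - R) * (F n x ^ 2 + g x ^ 2) :=
        mul_nonneg (by linarith) (by positivity)
      have hsq : 0 ≤ (1 + R) * (F n x + g x) ^ 2 := by positivity
      nlinarith
  have hmF : Measurable fun x => ENNReal.ofReal ((1 + x) * F n x ^ 2) :=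
    ((measurable_const.add measurable_id).mul ((hF n).measurable.pow_const 2)).ennreal_ofReal
  have hlint : ∫⁻ x in Ioi (0:ℝ), ENNReal.ofReal ((F n x - g x) ^ 2) ≤
      ENNReal.ofReal (δ ^ 2 * R + 4 * B / (1 + R)) := by
    calc _ ≤ ∫⁻ x in Ioi (0:ℝ), ((Ioc 0 R).indicator (fun _ => ENNReal.ofReal (δ ^ 2)) x +
          ENNReal.ofReal (2 / (1 + R)) * (ENNReal.ofReal ((1 + x) * F n x ^ 2) +
            ENNReal.ofReal ((1 + x) * g x ^ 2))) := setLIntegral_mono' measurableSet_Ioi hpt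
      _ = (∫⁻ x in Ioi (0:ℝ), (Ioc 0 R).indicator (fun _ => ENNReal.ofReal (δ ^ 2)) x) +
          ENNReal.ofReal (2 / (1 + R)) * ((∫⁻ x in Ioi (0:ℝ), ENNReal.ofReal ((1 + x) * F n x ^ 2))
            + ∫⁻ x in Ioi (0:ℝ), ENNReal.ofReal ((1 + x) * g x ^ 2)) := by
        rw [lintegral_add_left (measurable_const.indicator measurableSet_Ioc),
          lintegral_const_mul' _ _ ENNReal.ofReal_ne_top, lintegral_add_left hmF]
      _ ≤ ENNReal.ofReal (δ ^ 2) * ENNReal.ofReal R +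
          ENNReal.ofReal (2 / (1 + R)) * (ENNReal.ofReal B + ENNReal.ofReal B) := by
        gcongr
        · refine (setLIntegral_le_lintegral _ _).trans ?_
          rw [lintegral_indicator measurableSet_Ioc, setLIntegral_const, Real.volume_Ioc, sub_zero]
        · exact hFB n
      _ = ENNReal.ofReal (δ ^ 2 * R + 4 * B / (1 + R)) := by
        rw [← ENNReal.ofReal_add hB hB, ← ENNReal.ofReal_mul (by positivity),
          ← ENNReal.ofReal_mul (by positivity), ← ENNReal.ofReal_add (by positivity)
            (by positivity)]
        congr 1
        ring
  have hnonneg : 0 ≤ ∫ x in Ioi (0:ℝ), (F n x - g x) ^ 2 := integral_nonneg fun x => sq_nonneg _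
  have hcont : Continuous fun x => (F n x - g x) ^ 2 := ((hF n).sub hg).pow 2
  rw [Real.dist_eq, sub_zero, abs_of_nonneg hnonneg,
    integral_eq_lintegral_of_nonneg_ae (ae_of_all _ fun x => sq_nonneg _)
      hcont.aestronglyMeasurable]
  have := ENNReal.toReal_le_of_le_ofReal (by positivity) hlint
  linarith

/-- A bound on weighted `L²` norms passes to pointwise limits. -/
theorem lintegral_weighted_sq_le_of_tendsto {F : ℕ → ℝ → ℝ} {g : ℝ → ℝ} {C : ENNReal}
    (hF : ∀ n, Continuous (F n))
    (hFC : ∀ n, ∫⁻ x in Ioi (0:ℝ), ENNReal.ofReal ((1 + x) * F n x ^ 2) ≤ C)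
    (hlim : ∀ x, Tendsto (fun n => F n x) atTop (𝓝 (g x))) :
    ∫⁻ x in Ioi (0:ℝ), ENNReal.ofReal ((1 + x) * g x ^ 2) ≤ C := by
  have hliminf : ∀ x, liminf (fun n => ENNReal.ofReal ((1 + x) * F n x ^ 2)) atTop
      = ENNReal.ofReal ((1 + x) * g x ^ 2) := fun x =>
    (ENNReal.tendsto_ofReal (((hlim x).pow 2).const_mul (1 + x))).liminf_eq
  simp_rw [← hliminf]
  refine (lintegral_liminf_le fun n => ?_).trans ?_
  · exact ((measurable_const.add measurable_id).mul
      ((hF n).measurable.pow_const 2)).ennreal_ofReal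
  · exact liminf_le_of_le (by isBoundedDefault) fun b hb =>
      let ⟨n, hn⟩ := hb.exists
      hn.trans (hFC n)

/-- Compactness for `L*`-bounded sequences: a sequence bounded in the `L*` norm has a
subsequence converging in `L²([0,∞))` and uniformly on compacts to a continuous limit
`f` with `f(0) = 0` and `∫₀^∞ (1+x) f² ≤ B`. -/
theorem lstar_bounded_compactness
    (B : ℝ) (f : ℕ → ℝ → ℝ)
    (h0 : ∀ n, f n 0 = 0)
    (hdiff : ∀ n, ∀ x ∈ Ici (0:ℝ), DifferentiableAt ℝ (f n) x)
    (hbound : ∀ n,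
      (∫⁻ x in Ioi (0:ℝ),
        ENNReal.ofReal (deriv (f n) x ^ 2 + (1 + x) * f n x ^ 2)) ≤ ENNReal.ofReal B) :
    ∃ φ : ℕ → ℕ, StrictMono φ ∧
    ∃ g : ℝ → ℝ,
      ContinuousOn g (Ici (0:ℝ)) ∧ g 0 = 0 ∧
      (∫⁻ x in Ioi (0:ℝ), ENNReal.ofReal ((1 + x) * g x ^ 2)) ≤ ENNReal.ofReal B ∧
      Tendsto (fun j => ∫ x in Ioi (0:ℝ), (f (φ j) x - g x) ^ 2) atTop (𝓝 0) ∧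
      ∀ K : Set ℝ, K ⊆ Ici (0:ℝ) → IsCompact K →
        TendstoUniformlyOn (fun j => f (φ j)) g atTop K := by
  have hderiv : ∀ n, ∫⁻ x in Ioi (0:ℝ), ENNReal.ofReal (deriv (f n) x ^ 2) ≤
      ENNReal.ofReal (max B 0) := fun n => by
    refine (setLIntegral_mono' measurableSet_Ioi fun x hx => ENNReal.ofReal_le_ofReal ?_).trans
      ((hbound n).trans (ENNReal.ofReal_le_ofReal (le_max_left B 0)))
    have hx0 : 0 < x := hx
    exact le_add_of_nonneg_right (by positivity)
  set b : ℝ → ℝ := fun t => (max B 0 + 1) * √t with hb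
  have hb0 : Tendsto b (𝓝 0) (𝓝 0) := by
    have hcont : Continuous b := continuous_const.mul Real.continuous_sqrt
    simpa [hb] using hcont.tendsto 0
  have hmod : ∀ n x y, dist (f n (max x 0)) (f n (max y 0)) ≤ b (dist x y) := fun n x y => by
    refine (dist_le_mul_sqrt_of_lintegral_deriv_sq_le (le_max_right B 0) (hdiff n) (hderiv n)
      (le_max_right x 0) (le_max_right y 0)).trans ?_
    refine mul_le_mul_of_nonneg_left (Real.sqrt_le_sqrt ?_) (by positivity)
    exact abs_max_sub_max_le_abs x y 0
  let F : ℕ → C(ℝ, ℝ) := fun n => ⟨fun x => f n (max x 0),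
    (Metric.equicontinuous_of_continuity_modulus b hb0 (fun n x => f n (max x 0))
      fun x y n => hmod n x y).continuous n⟩
  have hFf : ∀ n, ∀ x ∈ Ici (0:ℝ), F n x = f n x := fun n x hx =>
    congrArg (f n) (max_eq_left hx)
  obtain ⟨g, hg, φ, hφ, hlim⟩ := (isCompact_setOf_dist_le_modulus (0:ℝ) hb0).tendsto_subseq
    (x := F) fun n => ⟨by rw [hFf n 0 self_mem_Ici, h0], hmod n⟩
  have hunif := ContinuousMap.tendsto_iff_forall_isCompact_tendstoUniformlyOn.1 hlim
  have hFB : ∀ n, ∫⁻ x in Ioi (0:ℝ), ENNReal.ofReal ((1 + x) * F n x ^ 2) ≤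
      ENNReal.ofReal B := fun n => by
    refine (setLIntegral_mono' measurableSet_Ioi fun x hx => ENNReal.ofReal_le_ofReal ?_).trans
      (hbound n)
    rw [hFf n x (Ioi_subset_Ici_self hx)]
    exact le_add_of_nonneg_left (sq_nonneg _)
  have hgB := lintegral_weighted_sq_le_of_tendsto (fun n => (F (φ n)).continuous)
    (fun n => hFB (φ n)) fun x => (hunif {x} isCompact_singleton).tendsto_at rfl
  refine ⟨φ, hφ, g, g.continuous.continuousOn, hg.1, hgB, ?_, fun K hK hKc =>
    (hunif K hKc).congr (Eventually.of_forall fun n x hx => hFf (φ n) x (hK hx))⟩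
  refine (tendsto_integral_sub_sq_of_weighted_bound (fun n => (F (φ n)).continuous)
    g.continuous (fun n => hFB (φ n)) hgB hunif).congr fun n => ?_
  refine setIntegral_congr_fun measurableSet_Ioi fun x hx => ?_
  simp only [hFf (φ n) x (Ioi_subset_Ici_self hx)]
end
end

section
/- Let β > 0 and let b : [0,∞) → ℝ be a continuous function such that, for some finite constant C, |b_{x+1} − b_x| ≤ C √(log(2 + x)) and |∫_x^{x+1} b_y dy − b_x| ≤ C √(log(2+x)) for all x ≥ 0. Then the infimum Λ_0 := inf{Q_b(f) : f ∈ L*, ‖f‖₂ = 1} is finite and is attained: there exists f₀ ∈ L* with ‖f₀‖₂ = 1 and Q_b(f₀) = Λ_0. Moreover, for every smooth compactly supported φ : (0,∞) → ℝ one has B_b(φ, f₀) = Λ_0 ⟨φ, f₀⟩_{L²}, where B_b denotes the symmetric bilinear form obtained from Q_b by polarization. -/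
open MeasureTheory Set Filter Topology

noncomputable section

/-- Membership in the space `L*`: `f 0 = 0`, `f` has a derivative on `[0,∞)`, and
`∫₀^∞ (f'² + (1+x) f²) < ∞`. -/
def MemLstar (f : ℝ → ℝ) : Prop :=
  f 0 = 0 ∧ (∀ x ∈ Ici (0:ℝ), DifferentiableAt ℝ f x) ∧
  IntegrableOn (fun x => deriv f x ^ 2 + (1 + x) * f x ^ 2) (Ioi (0:ℝ))

/-- The squared `L*` norm `‖f‖_*²`. -/
def starSq (f : ℝ → ℝ) : ℝ := ∫ x in Ioi (0:ℝ), (deriv f x ^ 2 + (1 + x) * f x ^ 2)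

/-- The squared `L²([0,∞))` norm. -/
def l2Sq (f : ℝ → ℝ) : ℝ := ∫ x in Ioi (0:ℝ), f x ^ 2

/-- The quadratic form `Q_b(f)`. -/
def Qform (β : ℝ) (b : ℝ → ℝ) (f : ℝ → ℝ) : ℝ :=
  (∫ x in Ioi (0:ℝ), (deriv f x ^ 2 + x * f x ^ 2)) +
  (2 / Real.sqrt β) * (∫ x in Ioi (0:ℝ), f x ^ 2 * (b (x + 1) - b x)) +
  (4 / Real.sqrt β) * (∫ x in Ioi (0:ℝ), deriv f x * f x * ((∫ y in x..(x + 1), b y) - b x))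

/-- The symmetric bilinear form obtained from `Q_b` by polarization. -/
def Bform (β : ℝ) (b : ℝ → ℝ) (f g : ℝ → ℝ) : ℝ :=
  (Qform β b (fun x => f x + g x) - Qform β b (fun x => f x - g x)) / 4

theorem exists_limit_minimizer {E : Type*} [NormedAddCommGroup E] [NormedSpace ℝ E]
    [CompleteSpace E] (D : Submodule ℝ E) (B N : E →L[ℝ] E →L[ℝ] ℝ)
    (hBs : ∀ x y, B x y = B y x) (hNs : ∀ x y, N x y = N y x) (hN0 : ∀ x, 0 ≤ N x x)
    (c K : ℝ) (hc : 0 < c) (hcoer : ∀ x, c * ‖x‖ ^ 2 ≤ B x x + K * N x x)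
    (hcomp : ∀ (u : ℕ → E) (M : ℝ), (∀ n, u n ∈ D) → (∀ n, ‖u n‖ ≤ M) →
      ∃ φ : ℕ → ℕ, StrictMono φ ∧
        Tendsto (fun p : ℕ × ℕ => N (u (φ p.1) - u (φ p.2)) (u (φ p.1) - u (φ p.2)))
          (atTop ×ˢ atTop) (𝓝 0))
    (hne : ∃ d ∈ D, N d d ≠ 0) :
    BddBelow {r : ℝ | ∃ d ∈ D, N d d = 1 ∧ r = B d d} ∧
    {r : ℝ | ∃ d ∈ D, N d d = 1 ∧ r = B d d}.Nonempty ∧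
    ∃ (u : ℕ → E) (e : E), (∀ n, u n ∈ D) ∧ Tendsto u atTop (𝓝 e) ∧ N e e = 1 ∧
      B e e = sInf {r : ℝ | ∃ d ∈ D, N d d = 1 ∧ r = B d d} ∧
      ∀ d ∈ D, B e d = sInf {r : ℝ | ∃ d ∈ D, N d d = 1 ∧ r = B d d} * N e d := by
  set S : Set ℝ := {r : ℝ | ∃ d ∈ D, N d d = 1 ∧ r = B d d} with hS
  have hbdd : BddBelow S := by
    refine ⟨-K, ?_⟩
    rintro r ⟨d, -, hd1, rfl⟩
    have h1 := hcoer d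
    rw [hd1] at h1
    nlinarith [mul_nonneg hc.le (sq_nonneg ‖d‖)]
  have hscale : ∀ d ∈ D, 0 < N d d → ∃ d' ∈ D, N d' d' = 1 ∧ B d' d' = B d d / N d d := by
    intro d hd hpos
    refine ⟨(Real.sqrt (N d d))⁻¹ • d, D.smul_mem _ hd, ?_, ?_⟩
    · simp only [map_smul, smul_apply, smul_eq_mul]
      rw [← mul_assoc, ← mul_inv, Real.mul_self_sqrt hpos.le, inv_mul_cancel₀ hpos.ne']
    · simp only [map_smul, smul_apply, smul_eq_mul]
      rw [← mul_assoc, ← mul_inv, Real.mul_self_sqrt hpos.le, div_eq_inv_mul]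
  have hSne : S.Nonempty := by
    obtain ⟨d, hd, hd0⟩ := hne
    obtain ⟨d', hd', h1, -⟩ := hscale d hd (lt_of_le_of_ne (hN0 d) hd0.symm)
    exact ⟨_, d', hd', h1, rfl⟩
  refine ⟨hbdd, hSne, ?_⟩
  set Λ := sInf S with hΛ
  set T : E →L[ℝ] E →L[ℝ] ℝ := B - Λ • N with hT
  have hTap : ∀ x y, T x y = B x y - Λ * N x y := fun x y => by simp [hT]
  have hTs : ∀ x y, T x y = T y x := fun x y => by rw [hTap, hTap, hBs, hNs]
  have hTnn : ∀ d ∈ D, 0 ≤ T d d := by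
    intro d hd
    rw [hTap]
    rcases (hN0 d).eq_or_lt with h0 | hpos
    · have h1 := hcoer d
      rw [← h0] at h1 ⊢
      nlinarith [mul_nonneg hc.le (sq_nonneg ‖d‖)]
    · obtain ⟨d', hd', h1, h2⟩ := hscale d hd hpos
      have h3 : Λ ≤ B d d / N d d := by
        rw [← h2]
        exact csInf_le hbdd ⟨d', hd', h1, rfl⟩
      rw [le_div_iff₀ hpos] at h3
      linarith
  obtain ⟨r, -, hr, hrS⟩ := exists_seq_tendsto_sInf hSne hbdd
  choose u huD hu1 hur using hrS
  obtain ⟨R, hR⟩ := hr.bddAbove_range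
  have hubd : ∀ n, ‖u n‖ ≤ Real.sqrt ((R + K) / c) := by
    intro n
    apply Real.le_sqrt_of_sq_le
    rw [le_div_iff₀ hc]
    have h1 := hcoer (u n)
    have h2 : r n ≤ R := hR ⟨n, rfl⟩
    rw [hu1, ← hur] at h1
    linarith
  obtain ⟨φ, hφ, hcauchy⟩ := hcomp u _ huD hubd
  have hTu : Tendsto (fun n => T (u (φ n)) (u (φ n))) atTop (𝓝 0) := by
    have h1 : Tendsto (fun n => r (φ n) - Λ) atTop (𝓝 (Λ - Λ)) :=
      (hr.comp hφ.tendsto_atTop).sub_const Λ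
    rw [sub_self] at h1
    refine h1.congr fun n => ?_
    rw [hTap, hu1, ← hur, mul_one]
  have hup : Tendsto (fun p : ℕ × ℕ => 2 * T (u (φ p.1)) (u (φ p.1)) +
      2 * T (u (φ p.2)) (u (φ p.2)) + (K + Λ) *
        N (u (φ p.1) - u (φ p.2)) (u (φ p.1) - u (φ p.2))) (atTop ×ˢ atTop) (𝓝 0) := by
    have h1 := hTu.comp (tendsto_fst (f := (atTop : Filter ℕ)) (g := (atTop : Filter ℕ)))
    have h2 := hTu.comp (tendsto_snd (f := (atTop : Filter ℕ)) (g := (atTop : Filter ℕ)))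
    simpa using ((h1.const_mul 2).add (h2.const_mul 2)).add (hcauchy.const_mul (K + Λ))
  have hnorm : Tendsto (fun p : ℕ × ℕ => ‖u (φ p.1) - u (φ p.2)‖ ^ 2)
      (atTop ×ˢ atTop) (𝓝 0) := by
    have h1 := hup.const_mul c⁻¹
    rw [mul_zero] at h1
    refine squeeze_zero (fun p => sq_nonneg _) (fun p => ?_) h1
    rw [le_inv_mul_iff₀ hc]
    set x := u (φ p.1)
    set y := u (φ p.2)
    have hadd : 0 ≤ T (x + y) (x + y) := hTnn _ (D.add_mem (huD _) (huD _))
    have h2 := hcoer (x - y)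
    have h3 := hTap (x - y) (x - y)
    have h4 : T (x - y) (x - y) = 2 * T x x + 2 * T y y - T (x + y) (x + y) := by
      simp only [map_sub, map_add, sub_apply, add_apply]
      ring
    linarith
  have hcs : CauchySeq (fun n => u (φ n)) := by
    rw [Metric.cauchySeq_iff]
    intro ε hε
    have h1 := hnorm.eventually (gt_mem_nhds (show (0:ℝ) < ε ^ 2 by positivity))
    rw [prod_atTop_atTop_eq, eventually_atTop] at h1
    obtain ⟨⟨a, b⟩, hab⟩ := h1
    refine ⟨max a b, fun m hm n hn => ?_⟩
    have h2 := hab (m, n) ⟨le_trans (le_max_left _ _) hm, le_trans (le_max_right _ _) hn⟩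
    rw [dist_eq_norm]
    exact lt_of_pow_lt_pow_left₀ 2 hε.le h2
  obtain ⟨e, he⟩ := cauchySeq_tendsto_of_complete hcs
  have hdiag : ∀ A : E →L[ℝ] E →L[ℝ] ℝ,
      Tendsto (fun n => A (u (φ n)) (u (φ n))) atTop (𝓝 (A e e)) := fun A =>
    ((show Continuous fun x => A x x by fun_prop).tendsto e).comp he
  have hNe : N e e = 1 :=
    tendsto_nhds_unique (hdiag N) (tendsto_const_nhds.congr fun n => (hu1 _).symm)
  have hTe : T e e = 0 := tendsto_nhds_unique (hdiag T) hTu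
  refine ⟨fun n => u (φ n), e, fun n => huD _, he, hNe, ?_, fun d hd => ?_⟩
  · have h1 := hTap e e
    rw [hTe, hNe] at h1
    linarith
  · have hcs : ∀ n, T (u (φ n)) d ^ 2 ≤ T (u (φ n)) (u (φ n)) * T d d := by
      intro n
      have h1 : ∀ t : ℝ, 0 ≤ T d d * (t * t) + 2 * T (u (φ n)) d * t +
          T (u (φ n)) (u (φ n)) := by
        intro t
        have h2 := hTnn _ (D.add_mem (huD (φ n)) (D.smul_mem t hd))
        simp only [map_add, map_smul, add_apply,
          smul_apply, smul_eq_mul] at h2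
        rw [hTs d] at h2
        linarith
      have h3 := discrim_le_zero h1
      rw [discrim] at h3
      linarith
    have h1 : Tendsto (fun n => T (u (φ n)) d ^ 2) atTop (𝓝 (T e d ^ 2)) :=
      ((show Continuous fun x => T x d ^ 2 by fun_prop).tendsto e).comp he
    have h2 : T e d ^ 2 ≤ 0 := by
      have h3 := hTu.mul_const (T d d)
      rw [zero_mul] at h3
      exact le_of_tendsto_of_tendsto' h1 h3 hcs
    have h4 : T e d = 0 := by nlinarith
    rw [hTap] at h4
    linarith

/-- Lebesgue measure on the open half-line. -/
abbrev halfLine : Measure ℝ := volume.restrict (Ioi (0:ℝ))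

/-- The Hilbert space `L²(0,∞)`. -/
abbrev HalfL2 : Type := Lp ℝ 2 halfLine

theorem ae_halfLine_pos : ∀ᵐ x ∂halfLine, 0 < x := ae_restrict_mem measurableSet_Ioi

theorem MemLstar.continuousOn {f : ℝ → ℝ} (hf : MemLstar f) : ContinuousOn f (Ici 0) :=
  fun x hx => (hf.2.1 x hx).continuousAt.continuousWithinAt

theorem MemLstar.memLp_deriv {f : ℝ → ℝ} (hf : MemLstar f) :
    MemLp (deriv f) 2 halfLine := by
  have hm : AEStronglyMeasurable (deriv f) halfLine := (measurable_deriv f).aestronglyMeasurable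
  rw [memLp_two_iff_integrable_sq hm]
  refine hf.2.2.mono' (hm.pow 2) ?_
  filter_upwards [ae_halfLine_pos] with x hx
  rw [Real.norm_of_nonneg (sq_nonneg _)]
  have : 0 ≤ (1 + x) * f x ^ 2 := by positivity
  linarith

theorem MemLstar.memLp_weighted {f : ℝ → ℝ} (hf : MemLstar f) :
    MemLp (fun x => Real.sqrt (1 + x) * f x) 2 halfLine := by
  have hm : AEStronglyMeasurable (fun x => Real.sqrt (1 + x) * f x) halfLine := by
    refine ContinuousOn.aestronglyMeasurable ?_ measurableSet_Ioi
    exact (by fun_prop : Continuous fun x : ℝ => Real.sqrt (1 + x)).continuousOn.mul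
      (hf.continuousOn.mono Ioi_subset_Ici_self)
  rw [memLp_two_iff_integrable_sq hm]
  refine hf.2.2.mono' (hm.pow 2) ?_
  filter_upwards [ae_halfLine_pos] with x hx
  rw [Real.norm_of_nonneg (sq_nonneg _), mul_pow, Real.sq_sqrt (by linarith)]
  linarith [sq_nonneg (deriv f x)]

theorem memLstar_of_memLp {f : ℝ → ℝ} (h0 : f 0 = 0)
    (hd : ∀ x ∈ Ici (0:ℝ), DifferentiableAt ℝ f x) (h1 : MemLp (deriv f) 2 halfLine)
    (h2 : MemLp (fun x => Real.sqrt (1 + x) * f x) 2 halfLine) : MemLstar f := by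
  refine ⟨h0, hd, (h1.integrable_sq.add h2.integrable_sq).congr ?_⟩
  filter_upwards [ae_halfLine_pos] with x hx
  simp only [Pi.add_apply]
  rw [mul_pow, Real.sq_sqrt (by linarith)]

/-- The pair `e = (u, v)` of square-integrable classes encodes `f ∈ L*` when `u = f'` and
`v = √(1+x) f` almost everywhere. -/
def Encodes (e : HalfL2 × HalfL2) (f : ℝ → ℝ) : Prop :=
  MemLstar f ∧ e.1 =ᵐ[halfLine] deriv f ∧ e.2 =ᵐ[halfLine] fun x => Real.sqrt (1 + x) * f x

theorem MemLstar.exists_encodes {f : ℝ → ℝ} (hf : MemLstar f) : ∃ e, Encodes e f :=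
  ⟨(hf.memLp_deriv.toLp, hf.memLp_weighted.toLp), hf, hf.memLp_deriv.coeFn_toLp,
    hf.memLp_weighted.coeFn_toLp⟩

theorem Encodes.add {e e' : HalfL2 × HalfL2} {f g : ℝ → ℝ} (hf : Encodes e f)
    (hg : Encodes e' g) : Encodes (e + e') (fun x => f x + g x) := by
  have h1 : (e + e').1 =ᵐ[halfLine] deriv fun x => f x + g x := by
    filter_upwards [Lp.coeFn_add e.1 e'.1, hf.2.1, hg.2.1, ae_halfLine_pos] with x h1 h2 h3 hx
    rw [Prod.fst_add, h1, Pi.add_apply, h2, h3]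
    exact (((hf.1.2.1 x hx.le).hasDerivAt.add (hg.1.2.1 x hx.le).hasDerivAt).deriv).symm
  have h2 : (e + e').2 =ᵐ[halfLine] fun x => Real.sqrt (1 + x) * (f x + g x) := by
    filter_upwards [Lp.coeFn_add e.2 e'.2, hf.2.2, hg.2.2] with x h1 h2 h3
    rw [Prod.snd_add, h1, Pi.add_apply, h2, h3, mul_add]
  refine ⟨memLstar_of_memLp (by simp [hf.1.1, hg.1.1]) (fun x hx => ?_)
    ((memLp_congr_ae h1).1 (Lp.memLp _)) ((memLp_congr_ae h2).1 (Lp.memLp _)), h1, h2⟩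
  exact (hf.1.2.1 x hx).add (hg.1.2.1 x hx)

theorem Encodes.smul {e : HalfL2 × HalfL2} {f : ℝ → ℝ} (t : ℝ) (hf : Encodes e f) :
    Encodes (t • e) (fun x => t * f x) := by
  have h1 : (t • e).1 =ᵐ[halfLine] deriv fun x => t * f x := by
    filter_upwards [Lp.coeFn_smul t e.1, hf.2.1, ae_halfLine_pos] with x h1 h2 hx
    rw [Prod.smul_fst, h1, Pi.smul_apply, h2, smul_eq_mul]
    exact (((hf.1.2.1 x hx.le).hasDerivAt.const_mul t).deriv).symm
  have h2 : (t • e).2 =ᵐ[halfLine] fun x => Real.sqrt (1 + x) * (t * f x) := by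
    filter_upwards [Lp.coeFn_smul t e.2, hf.2.2] with x h1 h2
    rw [Prod.smul_snd, h1, Pi.smul_apply, h2, smul_eq_mul]
    ring
  refine ⟨memLstar_of_memLp (by simp [hf.1.1]) (fun x hx => ?_)
    ((memLp_congr_ae h1).1 (Lp.memLp _)) ((memLp_congr_ae h2).1 (Lp.memLp _)), h1, h2⟩
  exact (hf.1.2.1 x hx).const_mul t

theorem Encodes.sub {e e' : HalfL2 × HalfL2} {f g : ℝ → ℝ} (hf : Encodes e f)
    (hg : Encodes e' g) : Encodes (e - e') (fun x => f x - g x) := by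
  simpa [sub_eq_add_neg] using hf.add (hg.smul (-1))

/-- The space `L*` as a subspace of `L² × L²`. -/
def lstarSubmodule : Submodule ℝ (HalfL2 × HalfL2) where
  carrier := {e | ∃ f, Encodes e f}
  add_mem' := by
    rintro e e' ⟨f, hf⟩ ⟨g, hg⟩
    exact ⟨_, hf.add hg⟩
  zero_mem' := by
    have h : MemLstar fun _ => 0 := ⟨rfl, fun x _ => by fun_prop, by simp⟩
    obtain ⟨e, he⟩ := h.exists_encodes
    exact ⟨_, by simpa using he.smul 0⟩
  smul_mem' := by
    rintro t e ⟨f, hf⟩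
    exact ⟨_, hf.smul t⟩

theorem MeasureTheory.Lp.integrable_bdd_mul_mul {α : Type*} [MeasurableSpace α] {μ : Measure α}
    {m : α → ℝ} (hm : AEStronglyMeasurable m μ) {K : ℝ} (hK : ∀ᵐ x ∂μ, |m x| ≤ K)
    (u v : Lp ℝ 2 μ) : Integrable (fun x => m x * (u x * v x)) μ :=
  ((Lp.memLp u).integrable_mul (Lp.memLp v)).bdd_mul (c := K) hm (by simpa using hK)

theorem MeasureTheory.Lp.exists_mulForm {α : Type*} [MeasurableSpace α] {μ : Measure α}
    {m : α → ℝ} (hm : AEStronglyMeasurable m μ) {K : ℝ} (hK : ∀ᵐ x ∂μ, |m x| ≤ K) :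
    ∃ A : Lp ℝ 2 μ →L[ℝ] Lp ℝ 2 μ →L[ℝ] ℝ, ∀ u v, A u v = ∫ x, m x * (u x * v x) ∂μ := by
  have hi := fun u v : Lp ℝ 2 μ => Lp.integrable_bdd_mul_mul hm hK u v
  refine ⟨LinearMap.mkContinuous₂ (LinearMap.mk₂ ℝ
    (fun u v : Lp ℝ 2 μ => ∫ x, m x * (u x * v x) ∂μ) ?_ ?_ ?_ ?_) |K| ?_, fun u v => rfl⟩
  · intro u u' v
    rw [← integral_add (hi _ _) (hi _ _)]
    refine integral_congr_ae ?_
    filter_upwards [Lp.coeFn_add u u'] with x hx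
    rw [hx, Pi.add_apply]
    ring
  · intro t u v
    rw [smul_eq_mul, ← integral_const_mul]
    refine integral_congr_ae ?_
    filter_upwards [Lp.coeFn_smul t u] with x hx
    rw [hx, Pi.smul_apply, smul_eq_mul]
    ring
  · intro u v v'
    rw [← integral_add (hi _ _) (hi _ _)]
    refine integral_congr_ae ?_
    filter_upwards [Lp.coeFn_add v v'] with x hx
    rw [hx, Pi.add_apply]
    ring
  · intro t u v
    rw [smul_eq_mul, ← integral_const_mul]
    refine integral_congr_ae ?_
    filter_upwards [Lp.coeFn_smul t v] with x hx
    rw [hx, Pi.smul_apply, smul_eq_mul]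
    ring
  · intro u v
    have hmul : Integrable (fun x => |u x| * |v x|) μ := by
      simpa [abs_mul] using ((Lp.memLp u).integrable_mul (Lp.memLp v)).norm
    have hcs : ∫ x, |u x| * |v x| ∂μ ≤ ‖u‖ * ‖v‖ := by
      have h1 := (Lp.memLp u).norm
      have h2 := (Lp.memLp v).norm
      have h3 : ∫ x, |u x| * |v x| ∂μ = inner ℝ (h1.toLp) (h2.toLp) := by
        rw [L2.inner_def]
        refine integral_congr_ae ?_
        filter_upwards [h1.coeFn_toLp, h2.coeFn_toLp] with x h4 h5
        rw [h4, h5]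
        simp [mul_comm]
      rw [h3]
      refine (real_inner_le_norm _ _).trans (le_of_eq ?_)
      rw [Lp.norm_toLp, Lp.norm_toLp, eLpNorm_norm, eLpNorm_norm, Lp.norm_def, Lp.norm_def]
    calc ‖∫ x, m x * (u x * v x) ∂μ‖ ≤ ∫ x, ‖m x * (u x * v x)‖ ∂μ :=
          norm_integral_le_integral_norm _
      _ ≤ ∫ x, |K| * (|u x| * |v x|) ∂μ := by
          refine integral_mono_ae (hi u v).norm (hmul.const_mul _) ?_
          filter_upwards [hK] with x hx
          simp only [norm_mul, Real.norm_eq_abs]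
          exact mul_le_mul_of_nonneg_right (hx.trans (le_abs_self K)) (by positivity)
      _ = |K| * ∫ x, |u x| * |v x| ∂μ := integral_const_mul _ _
      _ ≤ |K| * (‖u‖ * ‖v‖) := mul_le_mul_of_nonneg_left hcs (abs_nonneg K)
      _ = |K| * ‖u‖ * ‖v‖ := (mul_assoc _ _ _).symm

theorem exists_pairForm {p q r : ℝ → ℝ} (hp : AEStronglyMeasurable p halfLine)
    (hq : AEStronglyMeasurable q halfLine) (hr : AEStronglyMeasurable r halfLine) {K : ℝ}
    (hpK : ∀ᵐ x ∂halfLine, |p x| ≤ K) (hqK : ∀ᵐ x ∂halfLine, |q x| ≤ K)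
    (hrK : ∀ᵐ x ∂halfLine, |r x| ≤ K) :
    ∃ B : HalfL2 × HalfL2 →L[ℝ] HalfL2 × HalfL2 →L[ℝ] ℝ, ∀ e e',
      Integrable (fun x => p x * (e.1 x * e'.1 x) + q x * (e.2 x * e'.2 x) +
        r x * (e.1 x * e'.2 x + e.2 x * e'.1 x)) halfLine ∧
      B e e' = ∫ x, (p x * (e.1 x * e'.1 x) + q x * (e.2 x * e'.2 x) +
        r x * (e.1 x * e'.2 x + e.2 x * e'.1 x)) ∂halfLine := by
  obtain ⟨P, hP⟩ := Lp.exists_mulForm hp hpK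
  obtain ⟨Q, hQ⟩ := Lp.exists_mulForm hq hqK
  obtain ⟨R, hR⟩ := Lp.exists_mulForm hr hrK
  let π₁ := ContinuousLinearMap.fst ℝ HalfL2 HalfL2
  let π₂ := ContinuousLinearMap.snd ℝ HalfL2 HalfL2
  refine ⟨P.bilinearComp π₁ π₁ + Q.bilinearComp π₂ π₂ +
    (R.bilinearComp π₁ π₂ + R.bilinearComp π₂ π₁), fun e e' => ?_⟩
  have i1 := Lp.integrable_bdd_mul_mul hp hpK e.1 e'.1
  have i2 := Lp.integrable_bdd_mul_mul hq hqK e.2 e'.2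
  have i3 := Lp.integrable_bdd_mul_mul hr hrK e.1 e'.2
  have i4 := Lp.integrable_bdd_mul_mul hr hrK e.2 e'.1
  simp only [mul_add]
  refine ⟨(i1.add i2).add (i3.add i4), ?_⟩
  rw [integral_add (i1.fun_add i2) (i3.fun_add i4), integral_add i1 i2, integral_add i3 i4]
  simp [π₁, π₂, hP, hQ, hR]

/-- Continuous coefficients on `[0,∞)` growing at most like `√(log (2 + x))`. -/
structure LogBounded (C : ℝ) (a : ℝ → ℝ) : Prop where
  continuousOn : ContinuousOn a (Ici 0)
  abs_le : ∀ x, 0 ≤ x → |a x| ≤ C * Real.sqrt (Real.log (2 + x))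

theorem LogBounded.abs_le_sqrt {C : ℝ} {a : ℝ → ℝ} (ha : LogBounded C a) {x : ℝ} (hx : 0 ≤ x) :
    |a x| ≤ |C| * Real.sqrt (1 + x) := by
  have h1 : Real.log (2 + x) ≤ 1 + x := by
    have := Real.log_le_sub_one_of_pos (show 0 < 2 + x by linarith)
    linarith
  exact (ha.abs_le x hx).trans
    (mul_le_mul (le_abs_self C) (Real.sqrt_le_sqrt h1) (Real.sqrt_nonneg _) (abs_nonneg C))

theorem LogBounded.sq_le {C : ℝ} {a : ℝ → ℝ} (ha : LogBounded C a) {x : ℝ} (hx : 0 ≤ x) :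
    a x ^ 2 ≤ C ^ 2 * Real.log (2 + x) := by
  have h1 : 0 ≤ Real.log (2 + x) := Real.log_nonneg (by linarith)
  have h2 := pow_le_pow_left₀ (abs_nonneg _) (ha.abs_le x hx) 2
  rwa [sq_abs, mul_pow, Real.sq_sqrt h1] at h2

theorem Real.exists_const_mul_log_le (D : ℝ) (hD : 0 ≤ D) :
    ∃ K, ∀ x : ℝ, 0 ≤ x → D * Real.log (2 + x) ≤ x / 2 + K := by
  set δ : ℝ := 1 / (2 * (D + 1)) with hδ
  have hδ0 : 0 < δ := by positivity
  refine ⟨1 + D * |Real.log δ|, fun x hx => ?_⟩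
  have h1 := Real.log_le_sub_one_of_pos (show 0 < δ * (2 + x) by positivity)
  rw [Real.log_mul hδ0.ne' (by linarith)] at h1
  have h2 : Real.log (2 + x) ≤ δ * (2 + x) + |Real.log δ| := by
    linarith [neg_abs_le (Real.log δ)]
  have h3 : D * δ ≤ 1 / 2 := by
    rw [hδ, mul_one_div, div_le_div_iff₀ (by positivity) (by norm_num)]
    linarith
  have h4 := mul_le_mul_of_nonneg_left h2 hD
  nlinarith [mul_le_mul_of_nonneg_right h3 (show 0 ≤ 2 + x by linarith)]

/-- The quadratic form with coefficients `a`, `c` and coupling constant `k`. -/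
def coeffForm (k : ℝ) (a c f : ℝ → ℝ) : ℝ :=
  (∫ x in Ioi (0:ℝ), (deriv f x ^ 2 + x * f x ^ 2)) +
  k * (∫ x in Ioi (0:ℝ), f x ^ 2 * a x) +
  2 * k * (∫ x in Ioi (0:ℝ), deriv f x * f x * c x)

/-- The weight of `v v'` in the quadratic form on pairs. -/
def potWeight (k : ℝ) (a : ℝ → ℝ) (x : ℝ) : ℝ := x / (1 + x) + k * (a x / (1 + x))

/-- The weight of `u v' + v u'` in the quadratic form on pairs. -/
def crossWeight (k : ℝ) (c : ℝ → ℝ) (x : ℝ) : ℝ := k * (c x / Real.sqrt (1 + x))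

theorem aestronglyMeasurable_halfLine {m : ℝ → ℝ} (hm : ContinuousOn m (Ioi 0)) :
    AEStronglyMeasurable m halfLine :=
  hm.aestronglyMeasurable measurableSet_Ioi

theorem LogBounded.continuousOn_div {C : ℝ} {a : ℝ → ℝ} (ha : LogBounded C a) :
    ContinuousOn (fun x => a x / (1 + x)) (Ioi 0) :=
  (ha.continuousOn.mono Ioi_subset_Ici_self).div (by fun_prop)
    fun x (hx : 0 < x) => by positivity

theorem LogBounded.continuousOn_div_sqrt {C : ℝ} {c : ℝ → ℝ} (hc : LogBounded C c) :
    ContinuousOn (fun x => c x / Real.sqrt (1 + x)) (Ioi 0) :=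
  (hc.continuousOn.mono Ioi_subset_Ici_self).div (by fun_prop)
    fun x (hx : 0 < x) => by positivity

theorem LogBounded.abs_div_le {C : ℝ} {a : ℝ → ℝ} (ha : LogBounded C a) {x : ℝ} (hx : 0 ≤ x) :
    |a x / (1 + x)| ≤ |C| := by
  rw [abs_div, abs_of_pos (show 0 < 1 + x by linarith), div_le_iff₀ (by linarith)]
  refine (ha.abs_le_sqrt hx).trans (mul_le_mul_of_nonneg_left ?_ (abs_nonneg C))
  exact Real.sqrt_le_iff.2 ⟨by linarith, by nlinarith⟩

theorem LogBounded.abs_div_sqrt_le {C : ℝ} {c : ℝ → ℝ} (hc : LogBounded C c) {x : ℝ}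
    (hx : 0 ≤ x) : |c x / Real.sqrt (1 + x)| ≤ |C| := by
  have h : 0 < Real.sqrt (1 + x) := Real.sqrt_pos.2 (by linarith)
  rw [abs_div, abs_of_pos h, div_le_iff₀ h]
  exact hc.abs_le_sqrt hx

theorem continuousOn_div_one_add : ContinuousOn (fun x : ℝ => x / (1 + x)) (Ioi 0) :=
  continuousOn_id.div (by fun_prop) fun x (hx : 0 < x) => by positivity

theorem continuousOn_one_div_one_add : ContinuousOn (fun x : ℝ => 1 / (1 + x)) (Ioi 0) :=
  continuousOn_const.div (by fun_prop) fun x (hx : 0 < x) => by positivity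

theorem abs_div_one_add_le {x : ℝ} (hx : 0 ≤ x) : |x / (1 + x)| ≤ 1 := by
  rw [abs_of_nonneg (by positivity), div_le_one (by linarith)]
  linarith

theorem abs_one_div_one_add_le {x : ℝ} (hx : 0 ≤ x) : |1 / (1 + x)| ≤ 1 := by
  rw [abs_of_nonneg (by positivity), div_le_one (by linarith)]
  linarith

/-- The quadratic form as a bounded bilinear form on pairs. -/
theorem exists_energyForm (k : ℝ) {C : ℝ} {a c : ℝ → ℝ} (ha : LogBounded C a)
    (hc : LogBounded C c) :
    ∃ B : HalfL2 × HalfL2 →L[ℝ] HalfL2 × HalfL2 →L[ℝ] ℝ, ∀ e e',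
      Integrable (fun x => e.1 x * e'.1 x + potWeight k a x * (e.2 x * e'.2 x) +
        crossWeight k c x * (e.1 x * e'.2 x + e.2 x * e'.1 x)) halfLine ∧
      B e e' = ∫ x, (e.1 x * e'.1 x + potWeight k a x * (e.2 x * e'.2 x) +
        crossWeight k c x * (e.1 x * e'.2 x + e.2 x * e'.1 x)) ∂halfLine := by
  have hK : 0 ≤ |k| * |C| := by positivity
  obtain ⟨B, hB⟩ := exists_pairForm (p := fun _ => 1) (q := potWeight k a) (r := crossWeight k c)
    (K := 1 + |k| * |C|) aestronglyMeasurable_const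
    (aestronglyMeasurable_halfLine
      (continuousOn_div_one_add.add (continuousOn_const.mul ha.continuousOn_div)))
    (aestronglyMeasurable_halfLine (continuousOn_const.mul hc.continuousOn_div_sqrt))
    (Eventually.of_forall fun _ => by rw [abs_one]; linarith)
    (by
      filter_upwards [ae_halfLine_pos] with x hx
      refine (abs_add_le _ _).trans (add_le_add (abs_div_one_add_le hx.le) ?_)
      rw [abs_mul]
      exact mul_le_mul_of_nonneg_left (ha.abs_div_le hx.le) (abs_nonneg k))
    (by
      filter_upwards [ae_halfLine_pos] with x hx
      rw [crossWeight, abs_mul]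
      have := mul_le_mul_of_nonneg_left (hc.abs_div_sqrt_le hx.le) (abs_nonneg k)
      linarith)
  exact ⟨B, by simpa only [one_mul] using hB⟩

/-- The `L²` inner product as a bounded bilinear form on pairs. -/
theorem exists_massForm :
    ∃ N : HalfL2 × HalfL2 →L[ℝ] HalfL2 × HalfL2 →L[ℝ] ℝ, ∀ e e',
      Integrable (fun x => 1 / (1 + x) * (e.2 x * e'.2 x)) halfLine ∧
      N e e' = ∫ x, 1 / (1 + x) * (e.2 x * e'.2 x) ∂halfLine := by
  obtain ⟨N, hN⟩ := exists_pairForm (p := fun _ => 0) (q := fun x => 1 / (1 + x))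
    (r := fun _ => 0) (K := 1) aestronglyMeasurable_const
    (aestronglyMeasurable_halfLine continuousOn_one_div_one_add) aestronglyMeasurable_const
    (Eventually.of_forall fun _ => by simp)
    (by filter_upwards [ae_halfLine_pos] with x hx using abs_one_div_one_add_le hx.le)
    (Eventually.of_forall fun _ => by simp)
  exact ⟨N, by simpa only [zero_mul, zero_add, add_zero] using hN⟩

theorem Encodes.coeffForm_eq (k : ℝ) {C : ℝ} {a c : ℝ → ℝ} (ha : LogBounded C a)
    (hc : LogBounded C c) {e : HalfL2 × HalfL2} {f : ℝ → ℝ} (hf : Encodes e f) :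
    coeffForm k a c f = ∫ x, (e.1 x * e.1 x + potWeight k a x * (e.2 x * e.2 x) +
        crossWeight k c x * (e.1 x * e.2 x + e.2 x * e.1 x)) ∂halfLine := by
  have i0 : Integrable (fun x => e.1 x * e.1 x) halfLine :=
    (Lp.memLp e.1).integrable_mul (Lp.memLp e.1)
  have i1 := Lp.integrable_bdd_mul_mul (aestronglyMeasurable_halfLine continuousOn_div_one_add)
    (by filter_upwards [ae_halfLine_pos] with x hx using abs_div_one_add_le hx.le) e.2 e.2
  have i2 := Lp.integrable_bdd_mul_mul (aestronglyMeasurable_halfLine ha.continuousOn_div)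
    (by filter_upwards [ae_halfLine_pos] with x hx using ha.abs_div_le hx.le) e.2 e.2
  have i3 := Lp.integrable_bdd_mul_mul (aestronglyMeasurable_halfLine hc.continuousOn_div_sqrt)
    (by filter_upwards [ae_halfLine_pos] with x hx using hc.abs_div_sqrt_le hx.le) e.1 e.2
  have e1 : ∫ x in Ioi (0:ℝ), (deriv f x ^ 2 + x * f x ^ 2) =
      ∫ x, (e.1 x * e.1 x + x / (1 + x) * (e.2 x * e.2 x)) ∂halfLine := by
    refine integral_congr_ae ?_
    filter_upwards [hf.2.1, hf.2.2, ae_halfLine_pos] with x h1 h2 hx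
    rw [h1, h2, mul_mul_mul_comm, Real.mul_self_sqrt (by linarith)]
    field_simp
  have e2 : ∫ x in Ioi (0:ℝ), f x ^ 2 * a x =
      ∫ x, a x / (1 + x) * (e.2 x * e.2 x) ∂halfLine := by
    refine integral_congr_ae ?_
    filter_upwards [hf.2.2, ae_halfLine_pos] with x h2 hx
    rw [h2, mul_mul_mul_comm, Real.mul_self_sqrt (by linarith)]
    field_simp
  have e3 : ∫ x in Ioi (0:ℝ), deriv f x * f x * c x =
      ∫ x, c x / Real.sqrt (1 + x) * (e.1 x * e.2 x) ∂halfLine := by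
    refine integral_congr_ae ?_
    filter_upwards [hf.2.1, hf.2.2, ae_halfLine_pos] with x h1 h2 hx
    have : 0 < Real.sqrt (1 + x) := Real.sqrt_pos.2 (by linarith)
    rw [h1, h2]
    field_simp
  rw [coeffForm, e1, e2, e3, ← integral_const_mul, ← integral_const_mul,
    ← integral_add (i0.fun_add i1) (i2.const_mul k),
    ← integral_add ((i0.fun_add i1).fun_add (i2.const_mul k)) (i3.const_mul (2 * k))]
  refine integral_congr_ae (Eventually.of_forall fun x => ?_)
  simp only [potWeight, crossWeight]
  ring

theorem Encodes.integral_mul_eq {e e' : HalfL2 × HalfL2} {f g : ℝ → ℝ} (hf : Encodes e f)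
    (hg : Encodes e' g) :
    ∫ x in Ioi (0:ℝ), f x * g x = ∫ x, 1 / (1 + x) * (e.2 x * e'.2 x) ∂halfLine := by
  refine integral_congr_ae ?_
  filter_upwards [hf.2.2, hg.2.2, ae_halfLine_pos] with x h1 h2 hx
  rw [h1, h2, mul_mul_mul_comm, Real.mul_self_sqrt (by linarith)]
  field_simp

theorem exists_coercivity_const (k : ℝ) {C : ℝ} {a c : ℝ → ℝ} (ha : LogBounded C a)
    (hc : LogBounded C c) :
    ∃ K, ∀ x, 0 ≤ x →
      1 / 2 ≤ potWeight k a x + K * (1 / (1 + x)) - 2 * crossWeight k c x ^ 2 := by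
  obtain ⟨K, hK⟩ := Real.exists_const_mul_log_le (C ^ 2 + 2 * k ^ 2 * C ^ 2) (by positivity)
  refine ⟨K + 1 + k ^ 2, fun x hx => ?_⟩
  have h1 := hK x hx
  have h2 := ha.sq_le hx
  have h3 := mul_le_mul_of_nonneg_left (hc.sq_le hx) (show 0 ≤ 2 * k ^ 2 by positivity)
  have h4 : -(k * a x) ≤ k ^ 2 + a x ^ 2 := by nlinarith [sq_nonneg (k + a x), sq_nonneg (k - a x)]
  have h5 : potWeight k a x + (K + 1 + k ^ 2) * (1 / (1 + x)) - 2 * crossWeight k c x ^ 2 =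
      (x + k * a x + (K + 1 + k ^ 2) - 2 * k ^ 2 * c x ^ 2) / (1 + x) := by
    rw [potWeight, crossWeight, mul_pow, div_pow, Real.sq_sqrt (by linarith)]
    field_simp
  rw [h5, le_div_iff₀ (by linarith)]
  linarith

theorem MeasureTheory.Lp.norm_sq_eq_integral {α : Type*} [MeasurableSpace α] {μ : Measure α}
    (u : Lp ℝ 2 μ) : ‖u‖ ^ 2 = ∫ x, u x * u x ∂μ := by
  rw [← real_inner_self_eq_norm_sq, L2.inner_def]
  simp [pow_two]

theorem energy_coercive {k K : ℝ} {a c : ℝ → ℝ}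
    (hK : ∀ x, 0 ≤ x →
      1 / 2 ≤ potWeight k a x + K * (1 / (1 + x)) - 2 * crossWeight k c x ^ 2)
    (e : HalfL2 × HalfL2)
    (h1 : Integrable (fun x => e.1 x * e.1 x + potWeight k a x * (e.2 x * e.2 x) +
        crossWeight k c x * (e.1 x * e.2 x + e.2 x * e.1 x)) halfLine)
    (h2 : Integrable (fun x => 1 / (1 + x) * (e.2 x * e.2 x)) halfLine) :
    1 / 2 * ‖e‖ ^ 2 ≤ (∫ x, (e.1 x * e.1 x + potWeight k a x * (e.2 x * e.2 x) +
        crossWeight k c x * (e.1 x * e.2 x + e.2 x * e.1 x)) ∂halfLine) +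
      K * ∫ x, 1 / (1 + x) * (e.2 x * e.2 x) ∂halfLine := by
  have i1 : Integrable (fun x => e.1 x * e.1 x) halfLine :=
    (Lp.memLp e.1).integrable_mul (Lp.memLp e.1)
  have i2 : Integrable (fun x => e.2 x * e.2 x) halfLine :=
    (Lp.memLp e.2).integrable_mul (Lp.memLp e.2)
  have h3 : ‖e‖ ^ 2 ≤ ‖e.1‖ ^ 2 + ‖e.2‖ ^ 2 := by
    rw [Prod.norm_def]
    rcases max_cases ‖e.1‖ ‖e.2‖ with h | h <;> rw [h.1] <;>
      nlinarith [sq_nonneg ‖e.1‖, sq_nonneg ‖e.2‖]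
  have h4 : 1 / 2 * ‖e‖ ^ 2 ≤ ∫ x, 1 / 2 * (e.1 x * e.1 x + e.2 x * e.2 x) ∂halfLine := by
    rw [integral_const_mul, integral_add i1 i2, ← Lp.norm_sq_eq_integral,
      ← Lp.norm_sq_eq_integral]
    linarith
  refine h4.trans ?_
  rw [← integral_const_mul, ← integral_add h1 (h2.const_mul K)]
  refine integral_mono_ae ((i1.add i2).const_mul _) (h1.add (h2.const_mul K)) ?_
  filter_upwards [ae_halfLine_pos] with x hx
  have h5 := mul_le_mul_of_nonneg_right (hK x hx.le) (mul_self_nonneg (e.2 x))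
  nlinarith [sq_nonneg (e.1 x + 2 * crossWeight k c x * e.2 x)]

theorem MeasureTheory.MemLp.intervalIntegrable_of_halfLine {u : ℝ → ℝ}
    (hu : MemLp u 2 halfLine) {x : ℝ} (hx : 0 ≤ x) : IntervalIntegrable u volume 0 x := by
  rw [intervalIntegrable_iff_integrableOn_Ioc_of_le hx]
  have h : MemLp u 2 (volume.restrict (Ioc 0 x)) :=
    hu.mono_measure (Measure.restrict_mono Ioc_subset_Ioi_self le_rfl)
  exact h.integrable one_le_two

theorem halfLine_Ioc_ne_top (x : ℝ) : halfLine (Ioc 0 x) ≠ ⊤ :=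
  ((Measure.restrict_apply_le _ _).trans_lt measure_Ioc_lt_top).ne

theorem HalfL2.primitive_eq_inner (u : HalfL2) {x : ℝ} (hx : 0 ≤ x) :
    ∫ t in (0:ℝ)..x, u t =
      inner ℝ (indicatorConstLp 2 measurableSet_Ioc (halfLine_Ioc_ne_top x) (1:ℝ)) u := by
  rw [L2.inner_indicatorConstLp_one, intervalIntegral.integral_of_le hx,
    Measure.restrict_restrict_of_subset Ioc_subset_Ioi_self]

theorem Encodes.eq_primitive {e : HalfL2 × HalfL2} {f : ℝ → ℝ} (hf : Encodes e f) {x : ℝ}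
    (hx : 0 ≤ x) : f x = ∫ t in (0:ℝ)..x, e.1 t := by
  have h1 : ∫ t in (0:ℝ)..x, deriv f t = f x - f 0 := by
    refine intervalIntegral.integral_eq_sub_of_hasDerivAt (fun t ht => ?_)
      (hf.1.memLp_deriv.intervalIntegrable_of_halfLine hx)
    rw [uIcc_of_le hx] at ht
    exact (hf.1.2.1 t ht.1).hasDerivAt
  rw [hf.1.1, sub_zero] at h1
  rw [← h1, intervalIntegral.integral_of_le hx, intervalIntegral.integral_of_le hx]
  exact (integral_congr_ae (ae_restrict_of_ae_restrict_of_subset Ioc_subset_Ioi_self hf.2.1)).symm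

theorem HalfL2.primitive_sq_le (u : HalfL2) {x : ℝ} (hx : 0 ≤ x) :
    (∫ t in (0:ℝ)..x, u t) ^ 2 ≤ x * ‖u‖ ^ 2 := by
  rw [HalfL2.primitive_eq_inner u hx]
  have h1 := abs_real_inner_le_norm
    (indicatorConstLp 2 measurableSet_Ioc (halfLine_Ioc_ne_top x) (1:ℝ)) u
  have h2 := pow_le_pow_left₀ (abs_nonneg _) h1 2
  rw [sq_abs, mul_pow] at h2
  refine h2.trans (le_of_eq ?_)
  congr 1
  rw [← real_inner_self_eq_norm_sq, L2.real_inner_indicatorConstLp_one_indicatorConstLp_one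
      measurableSet_Ioc measurableSet_Ioc (halfLine_Ioc_ne_top x) (halfLine_Ioc_ne_top x),
    inter_self, Measure.real, Measure.restrict_apply measurableSet_Ioc,
    inter_eq_left.2 Ioc_subset_Ioi_self, Real.volume_Ioc, sub_zero, ENNReal.toReal_ofReal hx]

theorem exists_subseq_weakly_convergent {H : Type*} [NormedAddCommGroup H]
    [InnerProductSpace ℝ H] [CompleteSpace H] [TopologicalSpace.SeparableSpace H]
    (u : ℕ → H) (M : ℝ) (hM : ∀ n, ‖u n‖ ≤ M) :
    ∃ φ : ℕ → ℕ, StrictMono φ ∧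
      ∀ w : H, ∃ l : ℝ, Tendsto (fun n => inner ℝ w (u (φ n))) atTop (𝓝 l) := by
  obtain ⟨a, -, φ, hφ, ha⟩ := (WeakDual.isSeqCompact_closedBall ℝ H 0 M)
    (x := fun n => StrongDual.toWeakDual (InnerProductSpace.toDual ℝ H (u n)))
    (fun n => by simpa using hM n)
  refine ⟨φ, hφ, fun w => ⟨a w, ?_⟩⟩
  have h1 := ((WeakDual.eval_continuous w).tendsto a).comp ha
  refine h1.congr fun n => ?_
  rw [real_inner_comm]
  rfl

theorem Encodes.mass_le {e : HalfL2 × HalfL2} {f : ℝ → ℝ} (hf : Encodes e f) {R : ℝ}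
    (hR : 0 ≤ R) :
    ∫ x, 1 / (1 + x) * (e.2 x * e.2 x) ∂halfLine ≤
      (∫ x in Ioc 0 R, f x ^ 2) + (1 + R)⁻¹ * ‖e‖ ^ 2 := by
  have hfi : IntegrableOn (fun x => f x ^ 2) (Ioc 0 R) :=
    ((hf.1.continuousOn.mono Icc_subset_Ici_self).pow 2).integrableOn_Icc.mono_set
      Ioc_subset_Icc_self
  have hind : Integrable ((Ioc 0 R).indicator fun x => f x ^ 2) halfLine :=
    (hfi.integrable_indicator measurableSet_Ioc).mono_measure Measure.restrict_le_self
  have hv : Integrable (fun x => e.2 x * e.2 x) halfLine :=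
    (Lp.memLp e.2).integrable_mul (Lp.memLp e.2)
  have h1 : ∫ x in Ioc 0 R, f x ^ 2 =
      ∫ x, (Ioc 0 R).indicator (fun x => f x ^ 2) x ∂halfLine := by
    rw [integral_indicator measurableSet_Ioc,
      Measure.restrict_restrict_of_subset Ioc_subset_Ioi_self]
  have h2 : (1 + R)⁻¹ * ∫ x, e.2 x * e.2 x ∂halfLine ≤ (1 + R)⁻¹ * ‖e‖ ^ 2 := by
    rw [← Lp.norm_sq_eq_integral]
    have := norm_snd_le e
    gcongr
  rw [h1]
  refine le_trans ?_ (add_le_add_right h2 _)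
  rw [← integral_const_mul, ← integral_add hind (hv.const_mul _)]
  refine integral_mono_ae (Lp.integrable_bdd_mul_mul
    (aestronglyMeasurable_halfLine continuousOn_one_div_one_add)
    (by filter_upwards [ae_halfLine_pos] with x hx using abs_one_div_one_add_le hx.le) e.2 e.2)
    (hind.add (hv.const_mul _)) ?_
  filter_upwards [hf.2.2, ae_halfLine_pos] with x h3 hx
  by_cases hxR : x ≤ R
  · rw [indicator_of_mem (show x ∈ Ioc 0 R from ⟨hx, hxR⟩)]
    have h4 : 1 / (1 + x) * (e.2 x * e.2 x) = f x ^ 2 := by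
      rw [h3, mul_mul_mul_comm, Real.mul_self_sqrt (by linarith)]
      field_simp
    rw [h4]
    have : 0 ≤ (1 + R)⁻¹ * (e.2 x * e.2 x) := by
      have := mul_self_nonneg (e.2 x)
      positivity
    linarith
  · rw [indicator_of_notMem (fun h => hxR h.2), zero_add, ← one_div]
    push Not at hxR
    have := mul_self_nonneg (e.2 x)
    gcongr

/-- Bounded sequences in `L*` have subsequences that are Cauchy in `L²(0,∞)`. -/
theorem lstarSubmodule_compact (u : ℕ → HalfL2 × HalfL2) (M : ℝ)
    (hu : ∀ n, u n ∈ lstarSubmodule) (hM : ∀ n, ‖u n‖ ≤ M) :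
    ∃ φ : ℕ → ℕ, StrictMono φ ∧
      Tendsto (fun p : ℕ × ℕ => ∫ x, 1 / (1 + x) *
        ((u (φ p.1) - u (φ p.2)).2 x * (u (φ p.1) - u (φ p.2)).2 x) ∂halfLine)
          (atTop ×ˢ atTop) (𝓝 0) := by
  choose f hf using hu
  have : Fact ((2 : ENNReal) ≠ ⊤) := ⟨ENNReal.ofNat_ne_top⟩
  have hM0 : 0 ≤ M := (norm_nonneg _).trans (hM 0)
  obtain ⟨φ, hφ, hlim⟩ := exists_subseq_weakly_convergent (fun n => (u n).1) M
    fun n => (norm_fst_le _).trans (hM n)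
  refine ⟨φ, hφ, ?_⟩
  have hpt : ∀ x, 0 ≤ x → Tendsto (fun p : ℕ × ℕ => (f (φ p.1) x - f (φ p.2) x) ^ 2)
      (atTop ×ˢ atTop) (𝓝 0) := by
    intro x hx
    obtain ⟨l, hl⟩ := hlim (indicatorConstLp 2 measurableSet_Ioc (halfLine_Ioc_ne_top x) (1:ℝ))
    have h1 : Tendsto (fun n => f (φ n) x) atTop (𝓝 l) := by
      refine hl.congr fun n => ?_
      rw [(hf (φ n)).eq_primitive hx, HalfL2.primitive_eq_inner _ hx]
    have h2 := h1.comp (tendsto_fst (f := (atTop : Filter ℕ)) (g := (atTop : Filter ℕ)))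
    have h3 := h1.comp (tendsto_snd (f := (atTop : Filter ℕ)) (g := (atTop : Filter ℕ)))
    simpa using (h2.sub h3).pow 2
  have henc := fun p : ℕ × ℕ => (hf (φ p.1)).sub (hf (φ p.2))
  have hnorm : ∀ p : ℕ × ℕ, ‖u (φ p.1) - u (φ p.2)‖ ≤ 2 * M := fun p => by
    have := norm_sub_le (u (φ p.1)) (u (φ p.2))
    linarith [hM (φ p.1), hM (φ p.2)]
  have hloc : ∀ R : ℝ, 0 ≤ R → Tendsto (fun p : ℕ × ℕ =>
      ∫ x in Ioc 0 R, (f (φ p.1) x - f (φ p.2) x) ^ 2) (atTop ×ˢ atTop) (𝓝 0) := by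
    intro R hR
    suffices h : Tendsto (fun p : ℕ × ℕ => ∫ x in Ioc 0 R, (f (φ p.1) x - f (φ p.2) x) ^ 2)
        (atTop ×ˢ atTop) (𝓝 (∫ _ in Ioc 0 R, (0:ℝ))) by rwa [integral_zero] at h
    refine tendsto_integral_filter_of_dominated_convergence (fun _ => R * (2 * M) ^ 2)
      (Eventually.of_forall fun p => ?_) (Eventually.of_forall fun p => ?_) ?_ ?_
    · exact (((henc p).1.continuousOn.mono
        (Ioc_subset_Ioi_self.trans Ioi_subset_Ici_self)).pow 2).aestronglyMeasurable
          measurableSet_Ioc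
    · filter_upwards [ae_restrict_mem measurableSet_Ioc] with x hx
      rw [Real.norm_of_nonneg (sq_nonneg _), (henc p).eq_primitive hx.1.le]
      refine (HalfL2.primitive_sq_le _ hx.1.le).trans ?_
      have h1 := (norm_fst_le _).trans (hnorm p)
      gcongr
      exact hx.2
    · exact integrable_const _
    · filter_upwards [ae_restrict_mem measurableSet_Ioc] with x hx using hpt x hx.1.le
  rw [Metric.tendsto_nhds]
  intro ε hε
  set R : ℝ := 2 * (2 * M) ^ 2 / ε with hR
  have hR0 : 0 ≤ R := by positivity
  have htail : (1 + R)⁻¹ * (2 * M) ^ 2 < ε / 2 := by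
    rw [inv_mul_lt_iff₀ (by linarith)]
    have : R * (ε / 2) = (2 * M) ^ 2 := by
      rw [hR]
      field_simp
    nlinarith
  filter_upwards [(hloc R hR0).eventually (gt_mem_nhds (half_pos hε))] with p hp
  rw [Real.dist_eq, sub_zero, abs_of_nonneg]
  · have h1 := (henc p).mass_le hR0
    have h2 : (1 + R)⁻¹ * ‖u (φ p.1) - u (φ p.2)‖ ^ 2 ≤ (1 + R)⁻¹ * (2 * M) ^ 2 := by
      have := hnorm p
      gcongr
    linarith
  · refine integral_nonneg_of_ae ?_
    filter_upwards [ae_halfLine_pos] with x hx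
    exact mul_nonneg (by positivity) (mul_self_nonneg _)

theorem ae_eq_primitive_of_tendsto {u : ℕ → HalfL2 × HalfL2} {e : HalfL2 × HalfL2}
    (hu : ∀ n, u n ∈ lstarSubmodule) (he : Tendsto u atTop (𝓝 e)) :
    e.2 =ᵐ[halfLine] fun x => Real.sqrt (1 + x) * ∫ t in (0:ℝ)..x, e.1 t := by
  choose f hf using hu
  have h1 : Tendsto (fun n => (u n).1) atTop (𝓝 e.1) := (continuous_fst.tendsto e).comp he
  have h2 : Tendsto (fun n => (u n).2) atTop (𝓝 e.2) := (continuous_snd.tendsto e).comp he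
  obtain ⟨ns, hns, hae⟩ := (tendstoInMeasure_of_tendsto_Lp h2).exists_seq_tendsto_ae
  filter_upwards [hae, ae_all_iff.2 fun n => (hf n).2.2, ae_halfLine_pos] with x h3 h4 hx
  have h5 : Tendsto (fun n => f n x) atTop (𝓝 (∫ t in (0:ℝ)..x, e.1 t)) := by
    rw [HalfL2.primitive_eq_inner _ hx.le]
    refine (tendsto_const_nhds.inner h1).congr fun n => ?_
    rw [(hf n).eq_primitive hx.le, HalfL2.primitive_eq_inner _ hx.le]
  refine tendsto_nhds_unique h3 ?_
  refine ((h5.comp hns.tendsto_atTop).const_mul (Real.sqrt (1 + x))).congr fun n => ?_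
  exact (h4 _).symm

theorem continuousOn_primitive_Ici {R : ℝ → ℝ}
    (hR : ∀ x, 0 ≤ x → IntervalIntegrable R volume 0 x) :
    ContinuousOn (fun x => ∫ t in (0:ℝ)..x, R t) (Ici 0) := by
  intro x hx
  have hx1 : (0:ℝ) ≤ x + 1 := by linarith [mem_Ici.1 hx]
  have h1 := ((hR (x + 1) hx1).absolutelyContinuousOnInterval_intervalIntegral
    (c := 0) left_mem_uIcc).continuousOn
  rw [uIcc_of_le hx1] at h1
  refine (h1 x ⟨hx, by linarith⟩).mono_of_mem_nhdsWithin ?_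
  rw [← Ici_inter_Iic]
  exact inter_mem_nhdsWithin _ (Iic_mem_nhds (by linarith))

theorem memLstar_of_contDiff {φ : ℝ → ℝ} (hφ : ContDiff ℝ 1 φ) (h0 : φ 0 = 0)
    (hs : HasCompactSupport φ) : MemLstar φ := by
  have hd : Continuous (deriv φ) := hφ.continuous_deriv le_rfl
  have hc := hφ.continuous
  refine ⟨h0, fun x _ => (hφ.differentiable one_ne_zero) x, ?_⟩
  refine Integrable.integrableOn ?_
  have h1 : HasCompactSupport fun x => deriv φ x ^ 2 :=
    hs.deriv.comp_left (g := fun y : ℝ => y ^ 2) (by simp)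
  have h2 : HasCompactSupport fun x => (1 + x) * φ x ^ 2 :=
    (hs.comp_left (g := fun y : ℝ => y ^ 2) (by simp)).mul_left (f := fun x : ℝ => 1 + x)
  exact ((hd.pow 2).integrable_of_hasCompactSupport h1).add
    (Continuous.integrable_of_hasCompactSupport (by fun_prop) h2)

/-- Integration by parts against the primitive of a locally integrable function. -/
theorem integral_mul_eq_neg_primitive_mul_deriv {R φ : ℝ → ℝ} {n : ℝ}
    (hR : IntervalIntegrable R volume 0 n) (hφ : ContDiff ℝ 1 φ) (hφn : φ n = 0) :
    ∫ x in (0:ℝ)..n, R x * φ x = -∫ x in (0:ℝ)..n, (∫ t in (0:ℝ)..x, R t) * deriv φ x := by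
  have h1 := hR.absolutelyContinuousOnInterval_intervalIntegral (c := 0) left_mem_uIcc
  have h2 : AbsolutelyContinuousOnInterval φ 0 n :=
    hφ.contDiffOn.absolutelyContinuousOnInterval
  rw [h1.integral_mul_deriv_eq_deriv_mul h2, hφn, intervalIntegral.integral_same]
  simp only [mul_zero, zero_mul, sub_zero, zero_sub, neg_neg]
  refine intervalIntegral.integral_congr_ae ?_
  filter_upwards [hR.ae_hasDerivAt_integral] with x hx hxn
  rw [(hx (uIoc_subset_uIcc hxn) 0 left_mem_uIcc).deriv]

/-- If `P' = R` weakly on the half-line, then `P` is a.e. a primitive of `R`. -/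
theorem ae_eq_primitive_of_weak_deriv {P R : ℝ → ℝ}
    (hP : ∀ x, 0 ≤ x → IntervalIntegrable P volume 0 x)
    (hR : ∀ x, 0 ≤ x → IntervalIntegrable R volume 0 x)
    (h : ∀ φ : ℝ → ℝ, ContDiff ℝ 1 φ → φ 0 = 0 → HasCompactSupport φ →
      ∫ x in Ioi (0:ℝ), (P x * deriv φ x + R x * φ x) = 0) :
    ∃ κ, ∀ᵐ x ∂halfLine, P x = κ + ∫ t in (0:ℝ)..x, R t := by
  let b : ContDiffBump (1:ℝ) := ⟨1 / 4, 1 / 2, by norm_num, by norm_num⟩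
  set θ : ℝ → ℝ := b.normed volume with hθ
  have hθc : Continuous θ := (b.contDiff_normed (n := 0)).continuous
  have hθ1 : ∫ x, θ x = 1 := b.integral_normed
  have hθs : ∀ x, x ≤ 0 ∨ 2 ≤ x → θ x = 0 := by
    intro x hx
    refine image_eq_zero_of_notMem_tsupport fun hmem => ?_
    rw [hθ, b.tsupport_normed_eq, Metric.mem_closedBall, Real.dist_eq, abs_le] at hmem
    have h1 : b.rOut = 1 / 2 := rfl
    rw [h1] at hmem
    rcases hx with hx | hx <;> linarith [hmem.1, hmem.2]
  set S : ℝ → ℝ := fun x => ∫ t in (0:ℝ)..x, R t with hS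
  have hSc : ContinuousOn S (Ici 0) := continuousOn_primitive_Ici hR
  set W : ℝ → ℝ := fun x => P x - S x with hW
  have hSi : ∀ x, 0 ≤ x → IntervalIntegrable S volume 0 x := fun x hx =>
    (hSc.mono (by rw [uIcc_of_le hx]; exact Icc_subset_Ici_self)).intervalIntegrable
  have hWi : ∀ x, 0 ≤ x → IntervalIntegrable W volume 0 x := fun x hx => (hP x hx).sub (hSi x hx)
  have hglobal : ∀ (g : ℝ → ℝ) (n : ℝ), 0 ≤ n → (∀ x, x ≤ 0 ∨ n ≤ x → g x = 0) →
      ∫ x, g x = ∫ x in (0:ℝ)..n, g x := by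
    intro g n hn hg
    refine (intervalIntegral.integral_eq_integral_of_support_subset fun x hx => ?_).symm
    by_contra hcon
    refine hx (hg x ?_)
    by_contra! hcon'
    exact hcon ⟨hcon'.1, hcon'.2.le⟩
  set κ : ℝ := ∫ x, θ x * W x with hκ
  refine ⟨κ, ?_⟩
  have hloc : LocallyIntegrableOn (fun x => W x - κ) (Ioi 0) volume := by
    intro x hx
    have hx0 : 0 < x := hx
    refine ⟨Ioc 0 (x + 1), mem_nhdsWithin_of_mem_nhds (Ioc_mem_nhds hx (by linarith)), ?_⟩
    rw [← intervalIntegrable_iff_integrableOn_Ioc_of_le (by linarith)]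
    exact (hWi _ (by linarith)).sub intervalIntegrable_const
  have hzero := isOpen_Ioi.ae_eq_zero_of_integral_contDiff_smul_eq_zero hloc
    (fun ψ hψ hψs hψt => ?_)
  · rw [ae_restrict_iff' measurableSet_Ioi]
    filter_upwards [hzero] with x hx hx0
    have h1 := hx hx0
    simp only [hW] at h1
    linarith
  have hψc : Continuous ψ := hψ.continuous
  obtain ⟨n₀, hn₀⟩ := hψs.isCompact.bddAbove
  set n : ℝ := max 2 (n₀ + 1) with hn
  have hn2 : 2 ≤ n := le_max_left _ _
  have hn0 : 0 ≤ n := by linarith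
  have hψ0 : ∀ x, x ≤ 0 ∨ n ≤ x → ψ x = 0 := by
    intro x hx
    refine image_eq_zero_of_notMem_tsupport fun hmem => ?_
    rcases hx with hx | hx
    · exact absurd (hψt hmem) (not_lt.2 hx)
    · linarith [hn₀ hmem, le_max_right 2 (n₀ + 1)]
  set m : ℝ := ∫ x, ψ x with hm
  have hθ0 : ∀ x, x ≤ 0 ∨ n ≤ x → θ x = 0 := fun x hx =>
    hθs x (hx.imp_right fun hx => hn2.trans hx)
  set η : ℝ → ℝ := fun x => ψ x - m * θ x with hη
  have hηc : Continuous η := by fun_prop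
  have hη0 : ∀ x, x ≤ 0 ∨ n ≤ x → η x = 0 := fun x hx => by simp [hη, hψ0 x hx, hθ0 x hx]
  set φ : ℝ → ℝ := fun x => ∫ t in (0:ℝ)..x, η t with hφ
  have hφd : ∀ x, HasDerivAt φ (η x) x := fun x => hηc.integral_hasStrictDerivAt 0 x |>.hasDerivAt
  have hφd' : deriv φ = η := funext fun x => (hφd x).deriv
  have hφC : ContDiff ℝ 1 φ := by
    rw [contDiff_one_iff_deriv, hφd']
    exact ⟨fun x => (hφd x).differentiableAt, hηc⟩
  have hηint : ∫ x in (0:ℝ)..n, η x = 0 := by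
    rw [hη, intervalIntegral.integral_sub (hψc.intervalIntegrable _ _)
      ((hθc.const_mul m).intervalIntegrable _ _), intervalIntegral.integral_const_mul,
      ← hglobal ψ n hn0 hψ0, ← hglobal θ n hn0 hθ0, hθ1, mul_one, sub_self]
  have hφ0 : ∀ x, x ≤ 0 ∨ n ≤ x → φ x = 0 := by
    intro x hx
    rcases hx with hx | hx
    · refine (intervalIntegral.integral_congr (g := fun _ => 0) fun t ht => ?_).trans
        intervalIntegral.integral_zero
      rw [uIcc_of_ge hx] at ht
      exact hη0 t (Or.inl ht.2)
    · rw [hφ]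
      simp only
      rw [← intervalIntegral.integral_add_adjacent_intervals (hηc.intervalIntegrable 0 n)
        (hηc.intervalIntegrable n x), hηint, zero_add]
      refine (intervalIntegral.integral_congr (g := fun _ => 0) fun t ht => ?_).trans
        intervalIntegral.integral_zero
      rw [uIcc_of_le hx] at ht
      exact hη0 t (Or.inr ht.1)
  have hφs : HasCompactSupport φ := HasCompactSupport.intro (isCompact_Icc (a := 0) (b := n))
    fun x hx => hφ0 x (by
      by_contra! hcon
      exact hx ⟨hcon.1.le, hcon.2.le⟩)
  have hweak := h φ hφC (hφ0 0 (Or.inl le_rfl)) hφs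
  have hrestrict : ∫ x in Ioi (0:ℝ), (P x * η x + R x * φ x) =
      ∫ x in (0:ℝ)..n, (P x * η x + R x * φ x) := by
    rw [intervalIntegral.integral_of_le hn0]
    refine setIntegral_eq_of_subset_of_forall_sdiff_eq_zero measurableSet_Ioi
      Ioc_subset_Ioi_self fun x hx => ?_
    have hxn : n ≤ x := by
      by_contra! hcon
      exact hx.2 ⟨hx.1, hcon.le⟩
    rw [hη0 x (Or.inr hxn), hφ0 x (Or.inr hxn)]
    ring
  rw [hφd', hrestrict,
    intervalIntegral.integral_add ((hP n hn0).mul_continuousOn hηc.continuousOn)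
      ((hR n hn0).mul_continuousOn hφC.continuous.continuousOn),
    integral_mul_eq_neg_primitive_mul_deriv (hR n hn0) hφC (hφ0 n (Or.inr le_rfl)), hφd',
    ← sub_eq_add_neg, ← intervalIntegral.integral_sub
      ((hP n hn0).mul_continuousOn hηc.continuousOn)
      ((hSi n hn0).mul_continuousOn hηc.continuousOn)] at hweak
  have hWψ : IntervalIntegrable (fun x => ψ x * W x) volume 0 n :=
    (hWi n hn0).continuousOn_mul hψc.continuousOn
  have hWθ : IntervalIntegrable (fun x => θ x * W x) volume 0 n :=
    (hWi n hn0).continuousOn_mul hθc.continuousOn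
  have h3 : ∫ x in (0:ℝ)..n, (ψ x * W x - m * (θ x * W x)) = 0 := by
    refine Eq.trans (intervalIntegral.integral_congr fun x _ => ?_) hweak
    simp only [hη, hW, hS]
    ring
  rw [intervalIntegral.integral_sub hWψ (hWθ.const_mul m), intervalIntegral.integral_const_mul,
    ← hglobal (fun x => θ x * W x) n hn0 (fun x hx => by simp [hθ0 x hx]), ← hκ] at h3
  rw [hglobal (fun x => ψ x • (W x - κ)) n hn0 (fun x hx => by simp [hψ0 x hx])]
  simp only [smul_eq_mul, mul_sub]
  have hψκ : IntervalIntegrable (fun x => ψ x * κ) volume 0 n :=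
    (hψc.mul continuous_const).intervalIntegrable _ _
  rw [intervalIntegral.integral_sub hWψ hψκ,
    intervalIntegral.integral_mul_const, ← hglobal ψ n hn0 hψ0]
  linarith

theorem exists_encodes_of_weak_eq {k Λ C : ℝ} {a c : ℝ → ℝ} (ha : LogBounded C a)
    (hc : LogBounded C c) {e : HalfL2 × HalfL2}
    (he : e.2 =ᵐ[halfLine] fun x => Real.sqrt (1 + x) * ∫ t in (0:ℝ)..x, e.1 t)
    (h : ∀ d ∈ lstarSubmodule,
      ∫ x, (e.1 x * d.1 x + potWeight k a x * (e.2 x * d.2 x) +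
        crossWeight k c x * (e.1 x * d.2 x + e.2 x * d.1 x)) ∂halfLine =
      Λ * ∫ x, 1 / (1 + x) * (e.2 x * d.2 x) ∂halfLine) :
    ∃ f, Encodes e f := by
  obtain ⟨B, hB⟩ := exists_energyForm k ha hc
  obtain ⟨N, hN⟩ := exists_massForm
  set F : ℝ → ℝ := fun x => ∫ t in (0:ℝ)..x, e.1 t with hF
  have hui : ∀ x, 0 ≤ x → IntervalIntegrable e.1 volume 0 x := fun x hx =>
    (Lp.memLp e.1).intervalIntegrable_of_halfLine hx
  have hFc : ContinuousOn F (Ici 0) := continuousOn_primitive_Ici hui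
  have hsub : ∀ x : ℝ, 0 ≤ x → uIcc 0 x ⊆ Ici 0 := fun x hx => by
    rw [uIcc_of_le hx]
    exact Icc_subset_Ici_self
  have hcFc : ContinuousOn (fun x => k * c x * F x) (Ici 0) :=
    (continuousOn_const.mul hc.continuousOn).mul hFc
  have hpotc : ContinuousOn (fun x => (x + k * a x - Λ) * F x) (Ici 0) :=
    ((continuousOn_id.add (continuousOn_const.mul ha.continuousOn)).sub continuousOn_const).mul hFc
  set P : ℝ → ℝ := fun x => e.1 x + k * c x * F x with hP
  set R : ℝ → ℝ := fun x => (x + k * a x - Λ) * F x + e.1 x * (k * c x) with hR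
  have hPi : ∀ x, 0 ≤ x → IntervalIntegrable P volume 0 x := fun x hx =>
    (hui x hx).add (hcFc.mono (hsub x hx)).intervalIntegrable
  have hRi : ∀ x, 0 ≤ x → IntervalIntegrable R volume 0 x := fun x hx =>
    ((hpotc.mono (hsub x hx)).intervalIntegrable).add
      ((hui x hx).mul_continuousOn ((continuousOn_const.mul hc.continuousOn).mono (hsub x hx)))
  obtain ⟨κ, hκ⟩ := ae_eq_primitive_of_weak_deriv hPi hRi fun φ hφ hφ0 hφs => by
    obtain ⟨d, hd⟩ := (memLstar_of_contDiff hφ hφ0 hφs).exists_encodes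
    have h1 := h d ⟨φ, hd⟩
    rw [← sub_eq_zero, ← integral_const_mul,
      ← integral_sub (hB e d).1 ((hN e d).1.const_mul Λ)] at h1
    refine Eq.trans (integral_congr_ae ?_) h1
    filter_upwards [he, hd.2.1, hd.2.2, ae_halfLine_pos] with x h2 h3 h4 hx
    rw [h2, h3, h4]
    have hs0 : 0 < Real.sqrt (1 + x) := Real.sqrt_pos.2 (by linarith)
    have hs : Real.sqrt (1 + x) ^ 2 = 1 + x := Real.sq_sqrt (by linarith)
    have hx1 : 0 < 1 + x := by linarith
    change (e.1 x + k * c x * F x) * deriv φ x +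
        ((x + k * a x - Λ) * F x + e.1 x * (k * c x)) * φ x =
      e.1 x * deriv φ x + (x / (1 + x) + k * (a x / (1 + x))) *
        (Real.sqrt (1 + x) * F x * (Real.sqrt (1 + x) * φ x)) +
      k * (c x / Real.sqrt (1 + x)) * (e.1 x * (Real.sqrt (1 + x) * φ x) +
        Real.sqrt (1 + x) * F x * deriv φ x) -
      Λ * (1 / (1 + x) * (Real.sqrt (1 + x) * F x * (Real.sqrt (1 + x) * φ x)))
    rw [mul_mul_mul_comm, ← pow_two, hs]
    field_simp
    ring
  set g : ℝ → ℝ := fun x => κ + (∫ t in (0:ℝ)..x, R t) - k * c x * F x with hg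
  have hgc : ContinuousOn g (Ici 0) :=
    (continuousOn_const.add (continuousOn_primitive_Ici hRi)).sub hcFc
  have heg : e.1 =ᵐ[halfLine] g := by
    filter_upwards [hκ] with x hx
    simp only [hP] at hx
    simp only [hg]
    linarith
  set g' : ℝ → ℝ := fun x => g (max x 0) with hg'
  have hg'c : Continuous g' :=
    hgc.comp_continuous (by fun_prop) fun x => le_max_right x 0
  have hd : ∀ x, HasDerivAt (fun x => ∫ t in (0:ℝ)..x, g' t) (g' x) x := fun x =>
    (hg'c.integral_hasStrictDerivAt 0 x).hasDerivAt
  have h1 : e.1 =ᵐ[halfLine] deriv fun x => ∫ t in (0:ℝ)..x, g' t := by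
    filter_upwards [heg, ae_halfLine_pos] with x hx hx0
    rw [(hd x).deriv, hx, hg']
    simp only [max_eq_left hx0.le]
  have h2 : e.2 =ᵐ[halfLine] fun x => Real.sqrt (1 + x) * ∫ t in (0:ℝ)..x, g' t := by
    filter_upwards [he, ae_halfLine_pos] with x hx hx0
    rw [hx, intervalIntegral.integral_of_le hx0.le, intervalIntegral.integral_of_le hx0.le]
    congr 1
    refine integral_congr_ae (ae_restrict_of_ae_restrict_of_subset Ioc_subset_Ioi_self ?_)
    filter_upwards [h1] with t ht
    rw [ht, (hd t).deriv]
  exact ⟨_, memLstar_of_memLp intervalIntegral.integral_same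
    (fun x _ => (hd x).differentiableAt) ((memLp_congr_ae h1).1 (Lp.memLp _))
    ((memLp_congr_ae h2).1 (Lp.memLp _)), h1, h2⟩

theorem LogBounded.of_increment {C : ℝ} {b : ℝ → ℝ} (hb : ContinuousOn b (Ici (0:ℝ)))
    (h : ∀ x : ℝ, 0 ≤ x → |b (x + 1) - b x| ≤ C * Real.sqrt (Real.log (2 + x))) :
    LogBounded C fun x => b (x + 1) - b x := by
  refine ⟨(hb.comp (by fun_prop) fun x (hx : 0 ≤ x) => ?_).sub hb, h⟩
  exact mem_Ici.2 (by linarith)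

theorem LogBounded.of_average {C : ℝ} {b : ℝ → ℝ} (hb : ContinuousOn b (Ici (0:ℝ)))
    (h : ∀ x : ℝ, 0 ≤ x →
      |(∫ y in x..(x + 1), b y) - b x| ≤ C * Real.sqrt (Real.log (2 + x))) :
    LogBounded C fun x => (∫ y in x..(x + 1), b y) - b x := by
  refine ⟨ContinuousOn.sub ?_ hb, h⟩
  have hi : ∀ x, 0 ≤ x → IntervalIntegrable b volume 0 x := fun x hx =>
    (hb.mono (by rw [uIcc_of_le hx]; exact Icc_subset_Ici_self)).intervalIntegrable
  have hc := continuousOn_primitive_Ici hi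
  refine ((hc.comp (f := fun x => x + 1) (by fun_prop)
    fun x (hx : 0 ≤ x) => mem_Ici.2 (by linarith)).sub hc).congr fun x (hx : 0 ≤ x) => ?_
  exact (intervalIntegral.integral_interval_sub_left (hi _ (by linarith)) (hi _ hx)).symm

theorem exists_encodes_mass_ne_zero :
    ∃ e f, Encodes e f ∧ ∫ x, 1 / (1 + x) * (e.2 x * e.2 x) ∂halfLine ≠ 0 := by
  let b : ContDiffBump (1:ℝ) := ⟨1 / 4, 1 / 2, by norm_num, by norm_num⟩
  have hb0 : b 0 = 0 := b.zero_of_le_dist (by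
    rw [Real.dist_eq]
    change (1 / 2 : ℝ) ≤ _
    norm_num)
  obtain ⟨e, he⟩ :=
    (memLstar_of_contDiff (φ := b) b.contDiff hb0 b.hasCompactSupport).exists_encodes
  refine ⟨e, _, he, ?_⟩
  rw [← he.integral_mul_eq he]
  have hc : Continuous fun x => b x * b x := b.continuous.mul b.continuous
  have hs : HasCompactSupport fun x => b x * b x := b.hasCompactSupport.mul_left (f := b)
  refine ne_of_gt ((setIntegral_pos_iff_support_of_nonneg_ae
    (Eventually.of_forall fun x => mul_self_nonneg _)
    (hc.integrable_of_hasCompactSupport hs).integrableOn).2 ?_)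
  refine IsOpen.measure_pos _ (hc.isOpen_support.inter isOpen_Ioi) ⟨1, ?_, mem_Ioi.2 one_pos⟩
  rw [Function.mem_support, b.one_of_mem_closedBall (Metric.mem_closedBall_self b.rIn_pos.le)]
  norm_num

theorem Qform_eq_coeffForm (β : ℝ) (b f : ℝ → ℝ) :
    Qform β b f = coeffForm (2 / Real.sqrt β) (fun x => b (x + 1) - b x)
      (fun x => (∫ y in x..(x + 1), b y) - b x) f := by
  rw [Qform, coeffForm, mul_div_assoc' 2 2 (Real.sqrt β)]
  norm_num
/-- The ground state energy `Λ_0` is finite and attained by a minimizer `f₀`, which is an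
eigenfunction: it satisfies the weak Euler–Lagrange equation
`B_b(φ, f₀) = Λ_0 ⟨φ, f₀⟩` for all smooth compactly supported `φ` on `(0,∞)`. -/
theorem ground_state_exists
    (β : ℝ) (hβ : 0 < β) (b : ℝ → ℝ) (hb : ContinuousOn b (Ici (0:ℝ)))
    (C : ℝ)
    (hC1 : ∀ x : ℝ, 0 ≤ x → |b (x + 1) - b x| ≤ C * Real.sqrt (Real.log (2 + x)))
    (hC2 : ∀ x : ℝ, 0 ≤ x →
      |(∫ y in x..(x + 1), b y) - b x| ≤ C * Real.sqrt (Real.log (2 + x))) :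
    BddBelow { r : ℝ | ∃ f : ℝ → ℝ, MemLstar f ∧ l2Sq f = 1 ∧ r = Qform β b f } ∧
    { r : ℝ | ∃ f : ℝ → ℝ, MemLstar f ∧ l2Sq f = 1 ∧ r = Qform β b f }.Nonempty ∧
    ∃ f₀ : ℝ → ℝ, MemLstar f₀ ∧ l2Sq f₀ = 1 ∧
      Qform β b f₀ =
        sInf { r : ℝ | ∃ f : ℝ → ℝ, MemLstar f ∧ l2Sq f = 1 ∧ r = Qform β b f } ∧
      ∀ φ : ℝ → ℝ, ContDiff ℝ (⊤ : ℕ∞) φ → HasCompactSupport φ → tsupport φ ⊆ Ioi (0:ℝ) →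
        Bform β b φ f₀ =
          sInf { r : ℝ | ∃ f : ℝ → ℝ, MemLstar f ∧ l2Sq f = 1 ∧ r = Qform β b f } *
            ∫ x in Ioi (0:ℝ), φ x * f₀ x := by
  set k := 2 / Real.sqrt β with hk
  set a : ℝ → ℝ := fun x => b (x + 1) - b x with ha_def
  set c : ℝ → ℝ := fun x => (∫ y in x..(x + 1), b y) - b x with hc_def
  have ha : LogBounded C a := LogBounded.of_increment hb hC1
  have hc : LogBounded C c := LogBounded.of_average hb hC2
  obtain ⟨B, hB⟩ := exists_energyForm k ha hc
  obtain ⟨N, hN⟩ := exists_massForm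
  obtain ⟨K, hK⟩ := exists_coercivity_const k ha hc
  have hBs : ∀ e e', B e e' = B e' e := fun e e' => by
    rw [(hB e e').2, (hB e' e).2]
    congr with x
    ring
  have hNs : ∀ e e', N e e' = N e' e := fun e e' => by
    rw [(hN e e').2, (hN e' e).2]
    congr with x
    ring
  have hN0 : ∀ e, 0 ≤ N e e := fun e => by
    rw [(hN e e).2]
    refine integral_nonneg_of_ae ?_
    filter_upwards [ae_halfLine_pos] with x hx
    exact mul_nonneg (by positivity) (mul_self_nonneg _)
  have hcoer : ∀ e, 1 / 2 * ‖e‖ ^ 2 ≤ B e e + K * N e e := fun e => by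
    rw [(hB e e).2, (hN e e).2]
    exact energy_coercive hK e (hB e e).1 (hN e e).1
  have hcomp : ∀ (u : ℕ → HalfL2 × HalfL2) (M : ℝ), (∀ n, u n ∈ lstarSubmodule) →
      (∀ n, ‖u n‖ ≤ M) → ∃ φ : ℕ → ℕ, StrictMono φ ∧
        Tendsto (fun p : ℕ × ℕ => N (u (φ p.1) - u (φ p.2)) (u (φ p.1) - u (φ p.2)))
          (atTop ×ˢ atTop) (𝓝 0) := fun u M hu hM => by
    simp only [fun e e' => (hN e e').2]
    exact lstarSubmodule_compact u M hu hM
  have hne : ∃ d ∈ lstarSubmodule, N d d ≠ 0 := by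
    obtain ⟨d, f, hf, h⟩ := exists_encodes_mass_ne_zero
    exact ⟨d, ⟨f, hf⟩, by rwa [(hN d d).2]⟩
  have hmass : ∀ {e f}, Encodes e f → l2Sq f = N e e := fun {e f} hf => by
    rw [l2Sq, (hN e e).2, ← hf.integral_mul_eq hf]
    simp only [pow_two]
  have henergy : ∀ {e f}, Encodes e f → Qform β b f = B e e := fun {e f} hf => by
    rw [Qform_eq_coeffForm, (hB e e).2]
    exact hf.coeffForm_eq k ha hc
  have hset : {r : ℝ | ∃ f : ℝ → ℝ, MemLstar f ∧ l2Sq f = 1 ∧ r = Qform β b f} =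
      {r : ℝ | ∃ d ∈ lstarSubmodule, N d d = 1 ∧ r = B d d} := by
    ext r
    constructor
    · rintro ⟨f, hf, hf1, rfl⟩
      obtain ⟨e, he⟩ := hf.exists_encodes
      exact ⟨e, ⟨f, he⟩, (hmass he).symm.trans hf1, henergy he⟩
    · rintro ⟨e, ⟨f, he⟩, he1, rfl⟩
      exact ⟨f, he.1, (hmass he).trans he1, (henergy he).symm⟩
  rw [hset]
  obtain ⟨hbdd, hnonempty, u, e, hu, hue, he1, heB, hEL⟩ :=
    exists_limit_minimizer lstarSubmodule B N hBs hNs hN0 (1 / 2) K (by norm_num) hcoer hcomp hne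
  refine ⟨hbdd, hnonempty, ?_⟩
  obtain ⟨f₀, hf₀⟩ := exists_encodes_of_weak_eq ha hc (ae_eq_primitive_of_tendsto hu hue)
    fun d hd => by
      rw [← (hB e d).2, ← (hN e d).2]
      exact hEL d hd
  refine ⟨f₀, hf₀.1, (hmass hf₀).trans he1, (henergy hf₀).trans heB, fun φ hφ hφs hφt => ?_⟩
  have hφ0 : φ 0 = 0 := image_eq_zero_of_notMem_tsupport fun h0 =>
    lt_irrefl (0:ℝ) (hφt h0)
  obtain ⟨d, hd⟩ := (memLstar_of_contDiff (hφ.of_le (by norm_cast)) hφ0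
    hφs).exists_encodes
  rw [hd.integral_mul_eq hf₀, ← (hN d e).2, hNs, ← hEL d ⟨φ, hd⟩, Bform,
    henergy (hd.add hf₀), henergy (hd.sub hf₀)]
  simp only [map_add, map_sub, add_apply, sub_apply]
  rw [hBs d e]
  ring
end
end

section
/- For every real r > 0, the mean of a chi-distributed random variable with parameter r, namely √2 · Γ((r+1)/2)/Γ(r/2), satisfies √r · (1 − 4/r) ≤ √2 · Γ((r+1)/2)/Γ(r/2) ≤ √r, where Γ denotes the Gamma function. -/
open Real

/-- Midpoint log-convexity of the Gamma function on an interval of length one. -/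
theorem Gamma_add_half_sq_le {x : ℝ} (hx : 0 < x) :
    Real.Gamma (x + 1 / 2) ^ 2 ≤ x * Real.Gamma x ^ 2 := by
  have h := Real.Gamma_mul_add_mul_le_rpow_Gamma_mul_rpow_Gamma hx (add_pos hx one_pos)
    (half_pos one_pos) (half_pos one_pos) (add_halves 1)
  have hΓ := Real.Gamma_pos_of_pos hx
  have hΓ' := Real.Gamma_pos_of_pos (add_pos hx one_pos)
  rw [show 1 / 2 * x + 1 / 2 * (x + 1) = x + 1 / 2 by ring, ← Real.sqrt_eq_rpow,
    ← Real.sqrt_eq_rpow, ← Real.sqrt_mul hΓ.le] at h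
  calc Real.Gamma (x + 1 / 2) ^ 2 ≤ √(Real.Gamma x * Real.Gamma (x + 1)) ^ 2 :=
        pow_le_pow_left₀ (Real.Gamma_pos_of_pos (by positivity)).le h 2
    _ = x * Real.Gamma x ^ 2 := by
        rw [Real.sq_sqrt (by positivity), Real.Gamma_add_one hx.ne']
        ring

/-- Bounds on the mean of a chi-distributed random variable with parameter `r`:
`√r (1 - 4/r) ≤ √2 Γ((r+1)/2)/Γ(r/2) ≤ √r` for all real `r > 0`. -/
theorem chi_mean_bounds (r : ℝ) (hr : 0 < r) :
    Real.sqrt r * (1 - 4 / r) ≤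
        Real.sqrt 2 * (Real.Gamma ((r + 1) / 2) / Real.Gamma (r / 2)) ∧
      Real.sqrt 2 * (Real.Gamma ((r + 1) / 2) / Real.Gamma (r / 2)) ≤ Real.sqrt r := by
  have hA := Real.Gamma_pos_of_pos (half_pos hr)
  have hB : 0 < Real.Gamma ((r + 1) / 2) := Real.Gamma_pos_of_pos (by positivity)
  have hupper := Gamma_add_half_sq_le (half_pos hr)
  have hlower := Gamma_add_half_sq_le (x := (r + 1) / 2) (by positivity)
  rw [show r / 2 + 1 / 2 = (r + 1) / 2 by ring] at hupper
  rw [show (r + 1) / 2 + 1 / 2 = r / 2 + 1 by ring, Real.Gamma_add_one (half_pos hr).ne']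
    at hlower
  set A := Real.Gamma (r / 2)
  set B := Real.Gamma ((r + 1) / 2)
  have hsq : (√2 * (B / A)) ^ 2 = 2 * B ^ 2 / A ^ 2 := by
    rw [mul_pow, Real.sq_sqrt zero_le_two, div_pow, mul_div_assoc]
  constructor
  · rcases le_total r 4 with h4 | h4
    · refine (mul_nonpos_of_nonneg_of_nonpos (Real.sqrt_nonneg r) ?_).trans (by positivity)
      rw [sub_nonpos, le_div_iff₀ hr]
      linarith
    · refine abs_le_of_sq_le_sq' ?_ (by positivity) |>.2
      calc (√r * (1 - 4 / r)) ^ 2 = (r - 4) ^ 2 / r := by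
            rw [mul_pow, Real.sq_sqrt hr.le]
            field_simp
        _ ≤ r ^ 2 / (r + 1) := by
            rw [div_le_div_iff₀ hr (by positivity)]
            nlinarith
        _ ≤ 2 * B ^ 2 / A ^ 2 := by
            rw [div_le_div_iff₀ (by positivity) (by positivity)]
            linarith
        _ = (√2 * (B / A)) ^ 2 := hsq.symm
  · apply Real.le_sqrt_of_sq_le
    rw [hsq, div_le_iff₀ (by positivity)]
    linarith
end
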